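/- arXiv:1503.03604 — 2 statements merged into one kernel-verified Lean document; each statement's English description precedes it below -/
import Mathlib

section
/- The ideal H₀·𝓞_{K₃} of the ring of integers of K₃ generated by the image of H₀ is a principal ideal (i.e. the class of H₀ capitulates in the unramified quadratic extension K₃ = 𝕜(√2) of 𝕜). -/
open NumberField IntermediateField

/-- If `I² = -1` and `γ² = (4k+1)I`, then the ideal `(1+I, 1-γ)` is a square root of `(1+I)`. -/
lemma sq_span_one_add_one_sub {R : Type*} [CommRing R] {I γ : R} {k : ℕ} (hI : I ^ 2 = -1)
    (hγ : γ ^ 2 = (4 * k + 1) * I) :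
    Ideal.span {1 + I, 1 - γ} ^ 2 = Ideal.span {1 + I} := by
  apply le_antisymm
  · rw [sq, Ideal.span_mul_span', Ideal.span_le]
    rintro _ ⟨a, ha, b, hb, rfl⟩
    simp only [Set.mem_insert_iff, Set.mem_singleton_iff] at ha hb
    simp only [SetLike.mem_coe, Ideal.mem_span_singleton']
    rcases ha with rfl | rfl <;> rcases hb with rfl | rfl
    · exact ⟨1 + I, rfl⟩
    · exact ⟨1 - γ, by ring⟩
    · exact ⟨1 - γ, by ring⟩
    · refine ⟨1 - (1 - I) * γ + 2 * k * I * (1 - I), ?_⟩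
      linear_combination (γ - 2 * k * I) * hI - hγ
  · rw [Ideal.span_singleton_le_iff_mem]
    have h1 : 1 + I ∈ Ideal.span {1 + I, 1 - γ} := Ideal.subset_span (by simp)
    have h2 : 1 - γ ∈ Ideal.span {1 + I, 1 - γ} := Ideal.subset_span (by simp)
    have h3 := Ideal.pow_mem_pow h1 2
    have h4 := Ideal.pow_mem_pow h2 2
    have key : 1 + I = (1 - γ) ^ 2 + (1 + I) ^ 2 * (-I * (γ - 2 * k * I)) := by
      linear_combination (γ * I + 2 * γ - 2 * k * I ^ 2 - 4 * k * I) * hI - hγ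
    have h5 := add_mem h4 (Ideal.mul_mem_right (-I * (γ - 2 * k * I)) _ h3)
    rwa [← key] at h5

/-- If `ζ⁴ = -1`, then `(1-ζ)² = (1+ζ²)` as ideals. -/
lemma sq_span_one_sub {R : Type*} [CommRing R] {ζ : R} (hζ : (ζ ^ 2) ^ 2 = -1) :
    Ideal.span {1 - ζ} ^ 2 = Ideal.span {1 + ζ ^ 2} := by
  rw [← sq_span_one_add_one_sub (k := 0) (γ := ζ) hζ (by simp)]
  congr 1
  apply le_antisymm
  · exact Ideal.span_mono (by simp)
  · rw [Ideal.span_le]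
    rintro x (rfl | rfl)
    · exact Ideal.mem_span_singleton'.2 ⟨ζ ^ 2 * (1 + ζ), by linear_combination -hζ⟩
    · exact Ideal.mem_span_singleton_self _

lemma finrank_adjoin_simple_le_two {z : ℂ} {q : ℚ} (hz : z ^ 2 = algebraMap ℚ ℂ q) :
    Module.finrank ℚ ℚ⟮z⟯ ≤ 2 := by
  have hm : (Polynomial.X ^ 2 - Polynomial.C q).Monic :=
    Polynomial.monic_X_pow_sub_C q two_ne_zero
  have he : Polynomial.aeval z (Polynomial.X ^ 2 - Polynomial.C q) = 0 := by simp [hz]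
  rw [adjoin.finrank ⟨_, hm, he⟩]
  simpa using Polynomial.natDegree_le_of_dvd (minpoly.dvd ℚ z he) hm.ne_zero

lemma finrank_adjoin_pair_le_four {z w : ℂ} {q r : ℚ} (hz : z ^ 2 = algebraMap ℚ ℂ q)
    (hw : w ^ 2 = algebraMap ℚ ℂ r) : Module.finrank ℚ ℚ⟮z, w⟯ ≤ 4 := by
  have h : ℚ⟮z, w⟯ = ℚ⟮z⟯ ⊔ ℚ⟮w⟯ := by rw [← adjoin_union]; rfl
  rw [h]
  exact (finrank_sup_le _ _).trans
    (Nat.mul_le_mul (finrank_adjoin_simple_le_two hz) (finrank_adjoin_simple_le_two hw))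

/-- In a number field of degree at most `4`, a proper ideal with fourth power `(2)` is the only
prime above `2` that contains it. -/
lemma eq_of_pow_four_eq_span_two {K : Type*} [Field K] [NumberField K]
    (hK : Module.finrank ℚ K ≤ 4) {J P : Ideal (𝓞 K)} (hP : P.IsPrime)
    (hJP : J ≤ P) (hJ : J ^ 4 = Ideal.span {2}) : P = J := by
  have hN : Ideal.absNorm J ^ 4 ≤ 2 ^ 4 := by
    have h2 : Ideal.absNorm (Ideal.span {(2 : 𝓞 K)}) = 2 ^ Module.finrank ℚ K := by
      have := Ideal.absNorm_span_natCast (S := 𝓞 K) 2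
      rwa [RingOfIntegers.rank] at this
    rw [← map_pow, hJ, h2]
    exact Nat.pow_le_pow_right (by norm_num) hK
  have hle : Ideal.absNorm J ≤ 2 := (Nat.pow_le_pow_iff_left (by norm_num)).1 hN
  have h0 : J ≠ ⊥ := by
    rintro rfl
    have h : (2 : 𝓞 K) ∈ (⊥ : Ideal (𝓞 K)) ^ 4 := hJ ▸ Ideal.mem_span_singleton_self _
    simp at h
  have h0' : Ideal.absNorm J ≠ 0 := by rwa [Ne, Ideal.absNorm_eq_zero_iff]
  have h1 : Ideal.absNorm J ≠ 1 := by
    rw [Ne, Ideal.absNorm_eq_one_iff]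
    rintro rfl
    exact hP.ne_top (top_le_iff.1 hJP)
  have hprime : J.IsPrime := Ideal.isPrime_of_irreducible_absNorm (by
    rw [show Ideal.absNorm J = 2 by omega]
    exact Nat.prime_two)
  exact ((hprime.isMaximal h0).eq_of_le hP.ne_top hJP).symm

/-- The class of `H₀`, the unique prime of `𝓞_𝕜` above `2`, capitulates in
the unramified quadratic extension `K₃ = 𝕜(√2) = ℚ(√2, √(p₁p₂), i)` of `𝕜 = ℚ(√(2p₁p₂), i)`:
the ideal `H₀·𝓞_{K₃}` generated by the image of `H₀` (under any ring homomorphism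
`𝓞_𝕜 → 𝓞_{K₃}` compatible with the embeddings into `ℂ`, i.e. the inclusion) is principal. -/
theorem stmt_12 (p₁ p₂ : ℕ) (hp₁ : p₁.Prime) (hp₂ : p₂.Prime) (hne : p₁ ≠ p₂)
    (hm₁ : p₁ % 8 = 5) (hm₂ : p₂ % 8 = 5)
    (𝕜 K₃ : IntermediateField ℚ ℂ)
    (h𝕜 : 𝕜 = ℚ⟮((Real.sqrt (2 * (p₁ : ℝ) * p₂) : ℝ) : ℂ), Complex.I⟯)
    (hK₃ : K₃ = ℚ⟮((Real.sqrt 2 : ℝ) : ℂ), ((Real.sqrt ((p₁ : ℝ) * p₂) : ℝ) : ℂ), Complex.I⟯)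
    [NumberField 𝕜] [NumberField K₃]
    (H₀ : Ideal (RingOfIntegers 𝕜)) (hH₀p : H₀.IsPrime)
    (hH₀ : (2 : RingOfIntegers 𝕜) ∈ H₀)
    (φ : RingOfIntegers 𝕜 →+* RingOfIntegers K₃)
    (hφ : ∀ z : RingOfIntegers 𝕜,
      ((algebraMap (RingOfIntegers K₃) K₃ (φ z) : K₃) : ℂ)
        = ((algebraMap (RingOfIntegers 𝕜) 𝕜 z : 𝕜) : ℂ)) :
    (Ideal.map φ H₀).IsPrincipal := by
  have hsqrt (x : ℝ) (hx : 0 ≤ x) : ((√x : ℝ) : ℂ) ^ 2 = (x : ℂ) := by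
    rw [← Complex.ofReal_pow, Real.sq_sqrt hx]
  obtain ⟨k, hk⟩ : ∃ k, p₁ * p₂ = 4 * k + 1 := by
    have : p₁ * p₂ % 4 = 1 := by
      rw [Nat.mul_mod, show p₁ % 4 = 1 by omega, show p₂ % 4 = 1 by omega]
    exact ⟨p₁ * p₂ / 4, by omega⟩
  have hkC : (p₁ * p₂ : ℂ) = 4 * k + 1 := mod_cast hk
  set a : ℂ := ((√(2 * (p₁ : ℝ) * p₂) : ℝ) : ℂ) with ha
  have ha2 : a ^ 2 = 2 * (4 * k + 1) := by
    rw [hsqrt _ (by positivity), ← hkC]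
    push_cast
    ring
  set b : ℂ := ((√2 : ℝ) : ℂ) with hb
  have hb2 : b ^ 2 = 2 := by
    rw [hsqrt _ (by norm_num)]
    norm_num
  have haK : a ∈ 𝕜 := h𝕜 ▸ subset_adjoin ℚ _ (by simp)
  have hiK : Complex.I ∈ 𝕜 := h𝕜 ▸ subset_adjoin ℚ _ (by simp)
  have hbL : b ∈ K₃ := hK₃ ▸ subset_adjoin ℚ _ (by simp)
  have hiL : Complex.I ∈ K₃ := hK₃ ▸ subset_adjoin ℚ _ (by simp)
  have hdeg : Module.finrank ℚ 𝕜 ≤ 4 := by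
    subst h𝕜
    exact finrank_adjoin_pair_le_four (q := 2 * (4 * k + 1)) (r := -1) (by simp [ha2]) (by simp)
  have hI2 : (⟨Complex.I, hiK⟩ : 𝕜) ^ 2 = -1 := Subtype.ext (by simp)
  have hIint : IsIntegral ℤ (⟨Complex.I, hiK⟩ : 𝕜) :=
    .of_pow two_pos (hI2 ▸ isIntegral_one.neg)
  obtain ⟨I, hI⟩ : ∃ I : 𝓞 𝕜, algebraMap (𝓞 𝕜) 𝕜 I = ⟨Complex.I, hiK⟩ := ⟨⟨_, hIint⟩, rfl⟩
  have hγmem : a * (1 + Complex.I) / 2 ∈ 𝕜 :=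
    div_mem (mul_mem haK (add_mem (one_mem _) hiK)) (ofNat_mem 𝕜 2)
  have hγ2 : (⟨_, hγmem⟩ : 𝕜) ^ 2 = algebraMap (𝓞 𝕜) 𝕜 ((4 * k + 1) * I) := by
    rw [map_mul, hI]
    refine Subtype.ext ?_
    rw [map_add, map_mul, map_natCast, map_ofNat, map_one]
    change (a * (1 + Complex.I) / 2) ^ 2 = (4 * (k : ℂ) + 1) * Complex.I
    linear_combination ((1 + Complex.I) ^ 2 / 4) * ha2 + ((4 * k + 1) / 2) * Complex.I_sq
  obtain ⟨γ, hγ⟩ : ∃ γ : 𝓞 𝕜, algebraMap (𝓞 𝕜) 𝕜 γ = ⟨_, hγmem⟩ :=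
    ⟨⟨_, .of_pow two_pos (hγ2 ▸ RingOfIntegers.isIntegral_coe _)⟩, rfl⟩
  have hI' : I ^ 2 = -1 :=
    FaithfulSMul.algebraMap_injective (𝓞 𝕜) 𝕜 (by rw [map_pow, hI, hI2, map_neg, map_one])
  have hγ' : γ ^ 2 = (4 * k + 1) * I :=
    FaithfulSMul.algebraMap_injective (𝓞 𝕜) 𝕜 (by rw [map_pow, hγ, hγ2])
  have hJ := sq_span_one_add_one_sub hI' hγ'
  have hJ4 : Ideal.span {1 + I, 1 - γ} ^ 4 = Ideal.span {2} := by
    rw [show 4 = 2 * 2 from rfl, pow_mul, hJ, Ideal.span_singleton_pow,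
      Ideal.span_singleton_eq_span_singleton]
    exact ⟨⟨-I, I, by linear_combination -hI', by linear_combination -hI'⟩,
      by linear_combination (-2 - I) * hI'⟩
  have hJH : Ideal.span {1 + I, 1 - γ} ≤ H₀ :=
    hH₀p.le_of_pow_le (n := 4) (by rwa [hJ4, Ideal.span_singleton_le_iff_mem])
  have hH : H₀ = Ideal.span {1 + I, 1 - γ} := eq_of_pow_four_eq_span_two hdeg hH₀p hJH hJ4
  have hζmem : b * (1 + Complex.I) / 2 ∈ K₃ :=
    div_mem (mul_mem hbL (add_mem (one_mem _) hiL)) (ofNat_mem K₃ 2)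
  have hζ2 : (⟨_, hζmem⟩ : K₃) ^ 2 = algebraMap (𝓞 K₃) K₃ (φ I) := by
    refine Subtype.ext ?_
    rw [hφ, hI]
    push_cast
    linear_combination ((1 + Complex.I) ^ 2 / 4) * hb2 + (1 / 2) * Complex.I_sq
  obtain ⟨ζ, hζ⟩ : ∃ ζ : 𝓞 K₃, algebraMap (𝓞 K₃) K₃ ζ = ⟨_, hζmem⟩ :=
    ⟨⟨_, .of_pow two_pos (hζ2 ▸ RingOfIntegers.isIntegral_coe _)⟩, rfl⟩
  have hζ' : ζ ^ 2 = φ I :=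
    FaithfulSMul.algebraMap_injective (𝓞 K₃) K₃ (by rw [map_pow, hζ, hζ2])
  have hsq : Ideal.map φ H₀ ^ 2 = Ideal.span {1 - ζ} ^ 2 := by
    rw [sq_span_one_sub (by rw [hζ', ← map_pow, hI', map_neg, map_one]), hζ', hH,
      ← Ideal.map_pow, hJ, Ideal.map_span, Set.image_singleton, map_add, map_one]
  exact ⟨1 - ζ, pow_left_injective two_ne_zero hsq⟩
end

section
/- The ideal (H₁H₂)·𝓞_{K₃} of the ring of integers of K₃ generated by the image of the product H₁H₂ is principal if and only if ε₂·ε_{p₁p₂}·ε_{2p₁p₂} is not a square in K₃⁺. -/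
open NumberField IntermediateField

/-- `ε` is the fundamental unit of the real quadratic field `ℚ(√D)` (for `D > 1` squarefree):
elements of the ring of integers of `ℚ(√D)` are exactly the numbers `(x + y√D)/2` with
`x ≡ y·D (mod 2)`, and units are those with `x² - Dy² = ±4`.  The fundamental unit is the
least unit `> 1`; equivalently, every unit is of the form `±ε^k` with `k ∈ ℤ`. -/
def IsFundUnit (D : ℕ) (ε : ℝ) : Prop :=
  1 < ε ∧
  (∃ x y : ℤ, ε = ((x : ℝ) + (y : ℝ) * Real.sqrt D) / 2 ∧
    (x ^ 2 - (D : ℤ) * y ^ 2 = 4 ∨ x ^ 2 - (D : ℤ) * y ^ 2 = -4)) ∧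
  ∀ x y : ℤ, (x ^ 2 - (D : ℤ) * y ^ 2 = 4 ∨ x ^ 2 - (D : ℤ) * y ^ 2 = -4) →
    1 < ((x : ℝ) + (y : ℝ) * Real.sqrt D) / 2 →
    ε ≤ ((x : ℝ) + (y : ℝ) * Real.sqrt D) / 2

/-- A nonzero algebraic integer whose inverse is an algebraic integer. -/
def IsIntUnit {A : Type*} [Field A] (x : A) : Prop :=
  x ≠ 0 ∧ IsIntegral ℤ x ∧ IsIntegral ℤ x⁻¹

namespace IsIntUnit

variable {A B : Type*} [Field A] [Field B]

theorem mul {x y : A} (hx : IsIntUnit x) (hy : IsIntUnit y) : IsIntUnit (x * y) :=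
  ⟨mul_ne_zero hx.1 hy.1, hx.2.1.mul hy.2.1, by rw [mul_inv]; exact hx.2.2.mul hy.2.2⟩

theorem inv {x : A} (hx : IsIntUnit x) : IsIntUnit x⁻¹ :=
  ⟨inv_ne_zero hx.1, hx.2.2, by rw [inv_inv]; exact hx.2.1⟩

theorem div {x y : A} (hx : IsIntUnit x) (hy : IsIntUnit y) : IsIntUnit (x / y) := by
  rw [div_eq_mul_inv]; exact hx.mul hy.inv

theorem pow {x : A} (hx : IsIntUnit x) (n : ℕ) : IsIntUnit (x ^ n) :=
  ⟨pow_ne_zero n hx.1, hx.2.1.pow n, by rw [← inv_pow]; exact hx.2.2.pow n⟩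

theorem zpow {x : A} (hx : IsIntUnit x) (n : ℤ) : IsIntUnit (x ^ n) := by
  cases n with
  | ofNat n => simpa using hx.pow n
  | negSucc n => rw [zpow_negSucc]; exact (hx.pow _).inv

theorem of_sq {x : A} (hx : IsIntUnit (x ^ 2)) : IsIntUnit x :=
  ⟨fun h => hx.1 (by simp [h]), hx.2.1.of_pow two_pos,
    IsIntegral.of_pow two_pos (by rw [inv_pow]; exact hx.2.2)⟩

theorem map {x : A} (f : A →+* B) (hx : IsIntUnit x) : IsIntUnit (f x) :=
  ⟨(map_ne_zero f).2 hx.1, hx.2.1.map f.toIntAlgHom,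
    by rw [← map_inv₀]; exact hx.2.2.map f.toIntAlgHom⟩

theorem of_map {x : A} (f : A →+* B) (hx : IsIntUnit (f x)) : IsIntUnit x :=
  ⟨(map_ne_zero f).1 hx.1,
    (isIntegral_algHom_iff f.toIntAlgHom f.injective).1 hx.2.1,
    (isIntegral_algHom_iff f.toIntAlgHom f.injective).1
      (by have := hx.2.2; rw [← map_inv₀] at this; exact this)⟩

end IsIntUnit

theorem exists_add_mul_of_mem_adjoin_sqrt {k E : Type*} [Field k] [Field E] [Algebra k E]
    (F : IntermediateField k E) {r : E} (hr : r ^ 2 ∈ F) {x : E} (hx : x ∈ F⟮r⟯) :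
    ∃ a ∈ F, ∃ b ∈ F, x = a + b * r := by
  induction hx using IntermediateField.adjoin_induction with
  | mem x hx =>
    rw [Set.mem_singleton_iff] at hx
    exact ⟨0, F.zero_mem, 1, F.one_mem, by rw [hx]; ring⟩
  | algebraMap x => exact ⟨x, x.2, 0, F.zero_mem, by simp⟩
  | add x y _ _ hx hy =>
    obtain ⟨a, ha, b, hb, rfl⟩ := hx
    obtain ⟨c, hc, d, hd, rfl⟩ := hy
    exact ⟨a + c, F.add_mem ha hc, b + d, F.add_mem hb hd, by ring⟩
  | inv x _ hx =>
    obtain ⟨a, ha, b, hb, rfl⟩ := hx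
    by_cases h0 : a ^ 2 - b ^ 2 * r ^ 2 = 0
    · have hmem : a + b * r ∈ F := by
        by_cases hb0 : b = 0
        · simpa [hb0] using ha
        · have h1 : (a - b * r) * (a + b * r) = 0 := by linear_combination h0
          rcases mul_eq_zero.1 h1 with h | h
          · have : a + b * r = 2 * a := by linear_combination -h
            rw [this]; exact F.mul_mem (by exact ofNat_mem F 2) ha
          · rw [h]; exact F.zero_mem
      exact ⟨_, F.inv_mem hmem, 0, F.zero_mem, by simp⟩
    · have hm : a ^ 2 - b ^ 2 * r ^ 2 ∈ F :=
        F.sub_mem (_root_.pow_mem ha 2) (F.mul_mem (_root_.pow_mem hb 2) hr)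
      refine ⟨a / (a ^ 2 - b ^ 2 * r ^ 2), F.div_mem ha hm,
        -b / (a ^ 2 - b ^ 2 * r ^ 2), F.div_mem (F.neg_mem hb) hm, ?_⟩
      have h1 : a + b * r ≠ 0 := by
        rintro h; apply h0; linear_combination (a - b * r) * h
      field_simp
      ring
  | mul x y _ _ hx hy =>
    obtain ⟨a, ha, b, hb, rfl⟩ := hx
    obtain ⟨c, hc, d, hd, rfl⟩ := hy
    exact ⟨a * c + b * d * r ^ 2, F.add_mem (F.mul_mem ha hc) (F.mul_mem (F.mul_mem hb hd) hr),
      a * d + b * c, F.add_mem (F.mul_mem ha hd) (F.mul_mem hb hc), by ring⟩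

theorem exists_hom_adjoin_sqrt {k E : Type*} [Field k] [Field E] [Algebra k E]
    (F : IntermediateField k E) {r : E} (hr : r ^ 2 ∈ F) (hn : r ∉ F) :
    ∃ ψ : F⟮r⟯ →+* E, (∀ x : F⟮r⟯, (x : E) ∈ F → ψ x = x) ∧
      ∀ x : F⟮r⟯, (x : E) = r → ψ x = -r := by
  have hmin : minpoly F r = Polynomial.X ^ 2 - Polynomial.C (⟨r ^ 2, hr⟩ : F) := by
    symm
    apply minpoly.eq_of_irreducible_of_monic
    · apply X_pow_sub_C_irreducible_of_prime Nat.prime_two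
      intro b hb
      have hb' : (b : E) ^ 2 = r ^ 2 := by simpa using congrArg (fun z : F => (z : E)) hb
      rcases sq_eq_sq_iff_eq_or_eq_neg.1 hb' with h | h
      · exact hn (h ▸ b.2)
      · exact hn (by rw [← neg_neg r, ← h]; exact F.neg_mem b.2)
    · simp
    · exact Polynomial.monic_X_pow_sub_C _ two_ne_zero
  have hint : IsIntegral F r := by
    refine ⟨Polynomial.X ^ 2 - Polynomial.C (⟨r ^ 2, hr⟩ : F),
      Polynomial.monic_X_pow_sub_C _ two_ne_zero, ?_⟩
    simp
  have hroot : -r ∈ (minpoly F r).aroots E := by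
    rw [Polynomial.mem_aroots]
    refine ⟨minpoly.ne_zero hint, ?_⟩
    rw [hmin]; simp
  let ψ := (algHomAdjoinIntegralEquiv F hint).symm ⟨-r, hroot⟩
  refine ⟨ψ.toRingHom, ?_, ?_⟩
  · intro x hx
    have : x = algebraMap F F⟮r⟯ ⟨x, hx⟩ := by ext; rfl
    conv_lhs => rw [this]
    exact ψ.commutes _
  · intro x hx
    have : x = AdjoinSimple.gen F r := by ext; simpa using hx
    rw [this]
    exact algHomAdjoinIntegralEquiv_symm_apply_gen F hint ⟨-r, hroot⟩

theorem mem_adjoin_simple_of_mem {k E : Type*} [Field k] [Field E] [Algebra k E]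
    (F : IntermediateField k E) {r x : E} (hx : x ∈ k⟮r⟯) : x ∈ F⟮r⟯ := by
  induction hx using IntermediateField.adjoin_induction with
  | mem x hx => exact subset_adjoin _ _ hx
  | algebraMap x => exact F⟮r⟯.algebraMap_mem (algebraMap k F x)
  | add x y _ _ hx hy => exact add_mem hx hy
  | inv x _ hx => exact inv_mem hx
  | mul x y _ _ hx hy => exact mul_mem hx hy

theorem exists_ratCast_add_mul_sqrt {D : ℕ} {x : ℝ} (hx : x ∈ ℚ⟮√(D : ℝ)⟯) :
    ∃ a b : ℚ, x = a + b * √(D : ℝ) := by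
  have hr : √(D : ℝ) ^ 2 ∈ (⊥ : IntermediateField ℚ ℝ) := by
    rw [Real.sq_sqrt (Nat.cast_nonneg D)]; exact _root_.natCast_mem _ D
  have hx' := mem_adjoin_simple_of_mem (⊥ : IntermediateField ℚ ℝ) hx
  obtain ⟨a, ha, b, hb, h⟩ := exists_add_mul_of_mem_adjoin_sqrt _ hr hx'
  obtain ⟨a', rfl⟩ := mem_bot.1 ha
  obtain ⟨b', rfl⟩ := mem_bot.1 hb
  exact ⟨a', b', by simpa using h⟩

theorem ratCast_add_mul_sqrt_mem (D : ℕ) (a b : ℚ) :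
    (a + b * √(D : ℝ) : ℝ) ∈ ℚ⟮√(D : ℝ)⟯ :=
  add_mem (SubfieldClass.ratCast_mem _ a)
    (mul_mem (SubfieldClass.ratCast_mem _ b) (mem_adjoin_simple_self _ _))

theorem irrational_sqrt_of_squarefree {D : ℕ} (hD : Squarefree D) (h1 : D ≠ 1) :
    Irrational √(D : ℝ) := by
  rw [irrational_sqrt_natCast_iff]
  rintro ⟨c, rfl⟩
  have := Nat.isUnit_iff.1 (hD c dvd_rfl)
  simp [this] at h1

theorem IsIntUnit.conj_sqrt {D : ℕ} (hD : Irrational √(D : ℝ)) {a b : ℚ}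
    (h : IsIntUnit (a + b * √(D : ℝ) : ℝ)) : IsIntUnit (a - b * √(D : ℝ) : ℝ) := by
  have hr : √(D : ℝ) ^ 2 ∈ (⊥ : IntermediateField ℚ ℝ) := by
    rw [Real.sq_sqrt (Nat.cast_nonneg D)]; exact _root_.natCast_mem _ D
  have hn : √(D : ℝ) ∉ (⊥ : IntermediateField ℚ ℝ) := by
    intro h
    obtain ⟨c, hc⟩ := mem_bot.1 h
    exact hD ⟨c, by simpa using hc⟩
  obtain ⟨ψ, -, h2⟩ := exists_hom_adjoin_sqrt _ hr hn
  let s : ((⊥ : IntermediateField ℚ ℝ))⟮√(D : ℝ)⟯ := ⟨√(D : ℝ), mem_adjoin_simple_self _ _⟩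
  have h3 : IsIntUnit ((a : ((⊥ : IntermediateField ℚ ℝ))⟮√(D : ℝ)⟯) + b * s) := by
    apply IsIntUnit.of_map (algebraMap _ ℝ)
    simpa [s] using h
  have h4 := h3.map ψ
  rw [map_add, map_mul, map_ratCast, map_ratCast, h2 s rfl] at h4
  rwa [mul_neg, ← sub_eq_add_neg] at h4

theorem exists_int_of_isIntegral_ratCast {a : ℚ} (h : IsIntegral ℤ (a : ℝ)) :
    ∃ n : ℤ, a = n := by
  have h1 : IsIntegral ℤ a := (isIntegral_algebraMap_iff (B := ℝ)
    (algebraMap ℚ ℝ).injective).1 (by simpa using h)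
  obtain ⟨n, hn⟩ := IsIntegrallyClosed.isIntegral_iff.1 h1
  exact ⟨n, by simpa using hn.symm⟩

theorem exists_int_of_squarefree_mul_sq {D : ℕ} (hD : Squarefree D) {b : ℚ} {n : ℤ}
    (h : (D : ℚ) * b ^ 2 = n) : ∃ m : ℤ, b = m := by
  have hd : (b.den : ℚ) ≠ 0 := by exact_mod_cast b.den_nz
  have h1 : (D : ℤ) * b.num ^ 2 = n * (b.den : ℤ) ^ 2 := by
    have h2 : (D : ℚ) * (b.num : ℚ) ^ 2 = n * (b.den : ℚ) ^ 2 := by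
      have hb : b * b.den = b.num := Rat.mul_den_eq_num b
      rw [← h, ← hb]; ring
    exact_mod_cast h2
  have h3 : (b.den : ℤ) ^ 2 ∣ (D : ℤ) * b.num ^ 2 := ⟨n, by rw [h1]; ring⟩
  have hc : IsCoprime ((b.den : ℤ) ^ 2) (b.num ^ 2) := by
    apply IsCoprime.pow
    rw [Int.isCoprime_iff_gcd_eq_one, Int.gcd_comm]
    simpa [Int.gcd] using b.reduced
  have h4 : (b.den : ℤ) ^ 2 ∣ (D : ℤ) := hc.dvd_of_dvd_mul_right h3
  have h5 : b.den * b.den ∣ D := by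
    rw [← pow_two]; exact_mod_cast h4
  have h6 : b.den = 1 := Nat.isUnit_iff.1 (hD _ h5)
  exact ⟨b.num, (Rat.den_eq_one_iff b).1 h6 |>.symm⟩

theorem isIntUnit_half_add_mul_sqrt {D : ℕ} {x y : ℤ}
    (h : x ^ 2 - (D : ℤ) * y ^ 2 = 4 ∨ x ^ 2 - (D : ℤ) * y ^ 2 = -4) :
    IsIntUnit (((x : ℝ) + (y : ℝ) * √(D : ℝ)) / 2) := by
  have hs : √(D : ℝ) ^ 2 = D := Real.sq_sqrt (Nat.cast_nonneg D)
  obtain ⟨N, hN, hN2⟩ : ∃ N : ℤ, x ^ 2 - (D : ℤ) * y ^ 2 = 4 * N ∧ N ^ 2 = 1 := by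
    rcases h with h | h
    · exact ⟨1, by omega, by norm_num⟩
    · exact ⟨-1, by omega, by norm_num⟩
  have hNR : (x : ℝ) ^ 2 - (D : ℝ) * y ^ 2 = 4 * N := by exact_mod_cast hN
  have hN2R : (N : ℝ) ^ 2 = 1 := by exact_mod_cast hN2
  have key : ∀ z : ℤ, (x : ℝ) ^ 2 - (D : ℝ) * z ^ 2 = 4 * N →
      IsIntegral ℤ (((x : ℝ) + (z : ℝ) * √(D : ℝ)) / 2) := by
    intro z hz
    refine ⟨Polynomial.X ^ 2 - Polynomial.C x * Polynomial.X + Polynomial.C N, ?_, ?_⟩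
    · monicity!
    · simp only [← Polynomial.aeval_def, map_add, map_sub, map_mul, map_pow, Polynomial.aeval_X,
        Polynomial.aeval_C]
      simp only [algebraMap_int_eq, eq_intCast]
      linear_combination (z : ℝ) ^ 2 / 4 * hs - hz / 4
  have e1 : (((x : ℝ) + (y : ℝ) * √(D : ℝ)) / 2) *
      (N * (((x : ℝ) + ((-y : ℤ) : ℝ) * √(D : ℝ)) / 2)) = 1 := by
    push_cast
    linear_combination N / 4 * hNR + hN2R - N * (y : ℝ) ^ 2 / 4 * hs
  refine ⟨left_ne_zero_of_mul_eq_one e1, key y hNR, ?_⟩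
  rw [inv_eq_of_mul_eq_one_right e1]
  refine IsIntegral.mul ?_ (key (-y) (by push_cast; linear_combination hNR))
  exact isIntegral_algebraMap (R := ℤ) (A := ℝ) (x := N)

theorem IsIntUnit.exists_half_int {D : ℕ} (hD : Squarefree D) (h1 : D ≠ 1) {a b : ℚ}
    (h : IsIntUnit (a + b * √(D : ℝ) : ℝ)) :
    ∃ x y : ℤ, (a + b * √(D : ℝ) : ℝ) = ((x : ℝ) + (y : ℝ) * √(D : ℝ)) / 2 ∧
      (x ^ 2 - (D : ℤ) * y ^ 2 = 4 ∨ x ^ 2 - (D : ℤ) * y ^ 2 = -4) := by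
  have hs : √(D : ℝ) ^ 2 = D := Real.sq_sqrt (Nat.cast_nonneg D)
  have hirr := irrational_sqrt_of_squarefree hD h1
  have h' := h.conj_sqrt hirr
  obtain ⟨x, hx⟩ : ∃ n : ℤ, 2 * a = n := by
    apply exists_int_of_isIntegral_ratCast
    have := h.2.1.add h'.2.1
    have e : ((2 * a : ℚ) : ℝ) = a + b * √(D : ℝ) + (a - b * √(D : ℝ)) := by push_cast; ring
    rw [e]; exact this
  have hmul := h.mul h'
  have e1 : ((a + b * √(D : ℝ)) * (a - b * √(D : ℝ)) : ℝ) = ((a ^ 2 - D * b ^ 2 : ℚ) : ℝ) := by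
    push_cast
    linear_combination -(b : ℝ) ^ 2 * hs
  rw [e1] at hmul
  obtain ⟨N, hN⟩ := exists_int_of_isIntegral_ratCast hmul.2.1
  obtain ⟨M, hM⟩ := exists_int_of_isIntegral_ratCast (a := (a ^ 2 - D * b ^ 2)⁻¹)
    (by have := hmul.2.2; rwa [← Rat.cast_inv] at this)
  have hNM : N * M = 1 := by
    have hne : (a ^ 2 - D * b ^ 2 : ℚ) ≠ 0 := by exact_mod_cast hmul.1
    have : (N : ℚ) * M = 1 := by rw [← hN, ← hM]; exact mul_inv_cancel₀ hne
    exact_mod_cast this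
  obtain ⟨y, hy⟩ : ∃ n : ℤ, 2 * b = n := by
    apply exists_int_of_squarefree_mul_sq hD (n := x ^ 2 - 4 * N)
    push_cast
    rw [← hx, ← hN]; ring
  refine ⟨x, y, ?_, ?_⟩
  · have hx' : (2 * a : ℝ) = x := by exact_mod_cast hx
    have hy' : (2 * b : ℝ) = y := by exact_mod_cast hy
    rw [← hx', ← hy']; ring
  · have e2 : x ^ 2 - (D : ℤ) * y ^ 2 = 4 * N := by
      have : (x : ℚ) ^ 2 - (D : ℚ) * y ^ 2 = 4 * N := by
        rw [← hx, ← hy, ← hN]; ring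
      exact_mod_cast this
    rcases Int.eq_one_or_neg_one_of_mul_eq_one hNM with h | h
    · left; rw [e2, h]; norm_num
    · right; rw [e2, h]; norm_num

namespace IsFundUnit

variable {D : ℕ} {ε : ℝ}

theorem isIntUnit (h : IsFundUnit D ε) : IsIntUnit ε := by
  obtain ⟨-, ⟨x, y, rfl, hxy⟩, -⟩ := h
  exact isIntUnit_half_add_mul_sqrt hxy

theorem pos (h : IsFundUnit D ε) : 0 < ε := zero_lt_one.trans h.1

theorem mem (h : IsFundUnit D ε) : ε ∈ ℚ⟮√(D : ℝ)⟯ := by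
  obtain ⟨-, ⟨x, y, rfl, hxy⟩, -⟩ := h
  have := ratCast_add_mul_sqrt_mem D (x / 2) (y / 2)
  convert this using 1
  push_cast; ring

/-- Positive units of a real quadratic field are powers of the fundamental unit. -/
theorem exists_zpow (h : IsFundUnit D ε) (hD : Squarefree D) (h1 : D ≠ 1) {u : ℝ}
    (hu : u ∈ ℚ⟮√(D : ℝ)⟯) (hunit : IsIntUnit u) (hpos : 0 < u) : ∃ k : ℤ, u = ε ^ k := by
  obtain ⟨k, hk1, hk2⟩ := exists_mem_Ico_zpow hpos h.1
  have hεk : 0 < ε ^ k := zpow_pos h.pos k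
  refine ⟨k, ?_⟩
  by_contra hne
  have hlt : ε ^ k < u := lt_of_le_of_ne hk1 (Ne.symm hne)
  have hmem : u / ε ^ k ∈ ℚ⟮√(D : ℝ)⟯ := div_mem hu (zpow_mem h.mem k)
  obtain ⟨a, b, hab⟩ := exists_ratCast_add_mul_sqrt hmem
  have hv : IsIntUnit (u / ε ^ k) := hunit.div (h.isIntUnit.zpow k)
  rw [hab] at hv
  obtain ⟨x, y, hxy, hN⟩ := hv.exists_half_int hD h1
  have hmin := h.2.2 x y hN (by rw [← hxy, ← hab, one_lt_div hεk]; exact hlt)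
  rw [← hxy, ← hab, le_div_iff₀ hεk] at hmin
  rw [zpow_add_one₀ h.pos.ne'] at hk2
  linarith

theorem exists_zpow_or (h : IsFundUnit D ε) (hD : Squarefree D) (h1 : D ≠ 1) {u : ℝ}
    (hu : u ∈ ℚ⟮√(D : ℝ)⟯) (hunit : IsIntUnit u) : ∃ k : ℤ, |u| = ε ^ k := by
  rcases abs_choice u with h2 | h2 <;> rw [h2]
  · exact h.exists_zpow hD h1 hu hunit (h2 ▸ abs_pos.2 hunit.1)
  · refine h.exists_zpow hD h1 (neg_mem hu) ?_ (h2 ▸ abs_pos.2 hunit.1)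
    refine IsIntUnit.of_sq ?_
    rw [neg_sq]; exact hunit.pow 2

theorem not_sq (h : IsFundUnit D ε) (hD : Squarefree D) (h1 : D ≠ 1) {u : ℝ}
    (hu : u ∈ ℚ⟮√(D : ℝ)⟯) (hsq : u ^ 2 = ε) : False := by
  have hunit : IsIntUnit u := IsIntUnit.of_sq (hsq ▸ h.isIntUnit)
  obtain ⟨k, hk⟩ := h.exists_zpow_or hD h1 hu hunit
  have h2 : ε ^ (k * 2) = ε ^ (1 : ℤ) := by
    rw [zpow_mul, ← hk, zpow_one, ← hsq]
    exact_mod_cast sq_abs u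
  have := zpow_right_injective₀ h.pos h.1.ne' h2
  omega

/-- The conjugate of the fundamental unit, with the sign of its norm. -/
theorem exists_int (h : IsFundUnit D ε) : ∃ x y : ℤ, 0 < x ∧ 0 < y ∧
    ε = ((x : ℝ) + (y : ℝ) * √(D : ℝ)) / 2 ∧
    (x ^ 2 - (D : ℤ) * y ^ 2 = 4 ∨ x ^ 2 - (D : ℤ) * y ^ 2 = -4) := by
  obtain ⟨hgt, ⟨x, y, hxy, hN⟩, -⟩ := h
  have hs : √(D : ℝ) ^ 2 = D := Real.sq_sqrt (Nat.cast_nonneg D)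
  have hs0 : 0 ≤ √(D : ℝ) := Real.sqrt_nonneg _
  have habs : |((x : ℝ) + (y : ℝ) * √(D : ℝ)) / 2| * |((x : ℝ) - (y : ℝ) * √(D : ℝ)) / 2| = 1 := by
    rw [← abs_mul]
    have e : ((x : ℝ) + (y : ℝ) * √(D : ℝ)) / 2 * (((x : ℝ) - (y : ℝ) * √(D : ℝ)) / 2) =
        ((x ^ 2 - (D : ℤ) * y ^ 2 : ℤ) : ℝ) / 4 := by
      push_cast; linear_combination -(y : ℝ) ^ 2 / 4 * hs
    rw [e]
    rcases hN with h | h <;> rw [h] <;> norm_num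
  rw [← hxy, abs_of_pos (by linarith)] at habs
  have hlt : |((x : ℝ) - (y : ℝ) * √(D : ℝ)) / 2| < 1 := by
    by_contra hcon
    push Not at hcon
    nlinarith
  obtain ⟨hl, hr⟩ := abs_lt.1 hlt
  refine ⟨x, y, ?_, ?_, hxy, hN⟩
  · have : (0 : ℝ) < x := by linarith
    exact_mod_cast this
  · have h2 : 0 < (y : ℝ) * √(D : ℝ) := by linarith
    have : (0 : ℝ) < y := pos_of_mul_pos_left h2 hs0
    exact_mod_cast this

theorem eq_one_add_sqrt_two (h : IsFundUnit 2 ε) : ε = 1 + √2 := by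
  obtain ⟨x, y, hx, hy, hxy, hN⟩ := h.exists_int
  have hmin := h.2.2 2 2 (by norm_num) (by
    have : (0 : ℝ) ≤ √((2 : ℕ) : ℝ) := Real.sqrt_nonneg _
    have : (1 : ℝ) ≤ √((2 : ℕ) : ℝ) := by rw [Real.one_le_sqrt]; norm_num
    push_cast at *; linarith)
  push_cast at hmin hN hxy
  have hs0 : 0 ≤ √(2 : ℝ) := Real.sqrt_nonneg _
  have hx2 : x % 2 = 0 := by
    by_contra hc
    have : x ^ 2 % 2 = 1 := by rw [pow_two, Int.mul_emod]; have : x % 2 = 1 := by omega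
                               simp [this]
    omega
  obtain ⟨x', rfl⟩ : ∃ x', x = 2 * x' := ⟨x / 2, by omega⟩
  have hy2 : y % 2 = 0 := by
    by_contra hc
    have : y ^ 2 % 2 = 1 := by rw [pow_two, Int.mul_emod]; have : y % 2 = 1 := by omega
                               simp [this]
    have e : (2 * x') ^ 2 = 4 * x' ^ 2 := by ring
    omega
  have h2 : (2 : ℝ) ≤ y := by exact_mod_cast (by omega : 2 ≤ y)
  have h3 : (2 : ℝ) ≤ ((2 * x' : ℤ) : ℝ) := by exact_mod_cast (by omega : 2 ≤ 2 * x')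
  rw [hxy] at hmin ⊢
  push_cast at h3 hmin ⊢
  have h4 := mul_le_mul_of_nonneg_right h2 hs0
  linarith

end IsFundUnit

theorem sqrt_not_mem_adjoin_sqrt {m n : ℕ} (hm : Irrational √(m : ℝ)) (hn : Irrational √(n : ℝ))
    (hmn : Irrational √((m * n : ℕ) : ℝ)) : √(m : ℝ) ∉ ℚ⟮√(n : ℝ)⟯ := by
  intro h
  obtain ⟨a, b, hab⟩ := exists_ratCast_add_mul_sqrt h
  have hsm : √(m : ℝ) ^ 2 = m := Real.sq_sqrt (Nat.cast_nonneg m)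
  have hsn : √(n : ℝ) ^ 2 = n := Real.sq_sqrt (Nat.cast_nonneg n)
  by_cases hb : b = 0
  · exact hm ⟨a, by rw [hab, hb]; simp⟩
  by_cases ha : a = 0
  · refine hmn ⟨b * n, ?_⟩
    rw [Nat.cast_mul, Real.sqrt_mul (Nat.cast_nonneg m), hab, ha]
    push_cast
    linear_combination -(b : ℝ) * hsn
  · refine hn ⟨(m - a ^ 2 - b ^ 2 * n) / (2 * a * b), ?_⟩
    have ha' : (a : ℝ) ≠ 0 := by exact_mod_cast ha
    have hb' : (b : ℝ) ≠ 0 := by exact_mod_cast hb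
    push_cast
    rw [div_eq_iff (by positivity), ← hsm, hab]
    linear_combination (b : ℝ) ^ 2 * hsn

/-- The automorphism of `k(s, r)` over `k(s)` that changes the sign of `r`. -/
theorem exists_hom_adjoin_pair {k E : Type*} [Field k] [Field E] [Algebra k E] {s r : E}
    (hr : r ^ 2 ∈ k⟮s⟯) (hn : r ∉ k⟮s⟯) :
    ∃ σ : k⟮s, r⟯ →+* E, (∀ x : k⟮s, r⟯, (x : E) ∈ k⟮s⟯ → σ x = x) ∧
      ∀ x : k⟮s, r⟯, (x : E) = r → σ x = -r := by
  obtain ⟨ψ, h1, h2⟩ := exists_hom_adjoin_sqrt _ hr hn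
  have hmem : ∀ x : k⟮s, r⟯, (x : E) ∈ (k⟮s⟯)⟮r⟯ := by
    rintro ⟨x, hx⟩
    rw [← adjoin_simple_adjoin_simple] at hx
    exact hx
  let ι : k⟮s, r⟯ →+* (k⟮s⟯)⟮r⟯ := RingHom.codRestrict (algebraMap k⟮s, r⟯ E) (k⟮s⟯)⟮r⟯ hmem
  exact ⟨ψ.comp ι, fun x hx => h1 (ι x) hx, fun x hx => h2 (ι x) hx⟩

/-- The field `ℚ(√2, √n)`. -/
noncomputable def biquad (n : ℕ) : IntermediateField ℚ ℝ := ℚ⟮√(2 : ℝ), √(n : ℝ)⟯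

namespace biquad

variable {n : ℕ}

theorem sqrt_two_mem : √(2 : ℝ) ∈ biquad n := subset_adjoin _ _ (by simp)

theorem sqrt_mem : √(n : ℝ) ∈ biquad n := subset_adjoin _ _ (by simp)

theorem adjoin_sqrt_two_le : ℚ⟮√(2 : ℝ)⟯ ≤ biquad n := by
  rw [adjoin_simple_le_iff]; exact sqrt_two_mem

theorem adjoin_sqrt_le : ℚ⟮√(n : ℝ)⟯ ≤ biquad n := by
  rw [adjoin_simple_le_iff]; exact sqrt_mem

theorem adjoin_sqrt_two_mul_le : ℚ⟮√((2 * n : ℕ) : ℝ)⟯ ≤ biquad n := by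
  rw [adjoin_simple_le_iff]
  push_cast
  rw [Real.sqrt_mul zero_le_two]
  exact mul_mem sqrt_two_mem sqrt_mem

theorem exists_coords {x : ℝ} (hx : x ∈ biquad n) :
    ∃ A B C E : ℚ, x = A + B * √(2 : ℝ) + C * √(n : ℝ) + E * (√(2 : ℝ) * √(n : ℝ)) := by
  rw [biquad, ← adjoin_simple_adjoin_simple] at hx
  have hr : √(n : ℝ) ^ 2 ∈ ℚ⟮√(2 : ℝ)⟯ := by
    rw [Real.sq_sqrt (Nat.cast_nonneg n)]; exact _root_.natCast_mem _ n
  obtain ⟨u, hu, v, hv, rfl⟩ := exists_add_mul_of_mem_adjoin_sqrt _ hr hx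
  obtain ⟨A, B, rfl⟩ := exists_ratCast_add_mul_sqrt (D := 2) (by exact_mod_cast hu)
  obtain ⟨C, E, rfl⟩ := exists_ratCast_add_mul_sqrt (D := 2) (by exact_mod_cast hv)
  exact ⟨A, B, C, E, by push_cast; ring⟩

theorem exists_homs (h2 : Irrational √(2 : ℝ)) (hn : Irrational √(n : ℝ))
    (h2n : Irrational √((2 * n : ℕ) : ℝ)) :
    ∃ σ τ : biquad n →+* ℝ,
      σ ⟨√2, sqrt_two_mem⟩ = √2 ∧ σ ⟨√(n : ℝ), sqrt_mem⟩ = -√(n : ℝ) ∧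
      τ ⟨√2, sqrt_two_mem⟩ = -√2 ∧ τ ⟨√(n : ℝ), sqrt_mem⟩ = √(n : ℝ) := by
  have h2' : Irrational √((2 : ℕ) : ℝ) := by exact_mod_cast h2
  have hn2 : Irrational √((n * 2 : ℕ) : ℝ) := by rwa [mul_comm]
  have hr : √(n : ℝ) ^ 2 ∈ ℚ⟮√(2 : ℝ)⟯ := by
    rw [Real.sq_sqrt (Nat.cast_nonneg n)]; exact _root_.natCast_mem _ n
  have hs : √(2 : ℝ) ^ 2 ∈ ℚ⟮√(n : ℝ)⟯ := by
    rw [Real.sq_sqrt zero_le_two]; exact ofNat_mem _ 2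
  have hrn : √(n : ℝ) ∉ ℚ⟮√(2 : ℝ)⟯ := by
    have := sqrt_not_mem_adjoin_sqrt hn h2' hn2
    exact_mod_cast this
  have hsn : √(2 : ℝ) ∉ ℚ⟮√(n : ℝ)⟯ := by
    have := sqrt_not_mem_adjoin_sqrt h2' hn h2n
    exact_mod_cast this
  obtain ⟨σ, hσ1, hσ2⟩ := exists_hom_adjoin_pair hr hrn
  obtain ⟨τ, hτ1, hτ2⟩ := exists_hom_adjoin_pair hs hsn
  have hle : ∀ x : biquad n, (x : ℝ) ∈ ℚ⟮√(n : ℝ), √(2 : ℝ)⟯ := by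
    rintro ⟨x, hx⟩
    rw [biquad, Set.pair_comm] at hx
    exact hx
  let ι : biquad n →+* ℚ⟮√(n : ℝ), √(2 : ℝ)⟯ :=
    RingHom.codRestrict (algebraMap (biquad n) ℝ) ℚ⟮√(n : ℝ), √(2 : ℝ)⟯ hle
  refine ⟨σ, τ.comp ι, hσ1 _ (mem_adjoin_simple_self _ _), hσ2 _ rfl, ?_, ?_⟩
  · exact hτ2 (ι ⟨√2, sqrt_two_mem⟩) rfl
  · exact hτ1 (ι ⟨√(n : ℝ), sqrt_mem⟩) (mem_adjoin_simple_self _ _)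

theorem map_coords (f : biquad n →+* ℝ) {x : biquad n} {A B C E : ℚ}
    (h : (x : ℝ) = A + B * √(2 : ℝ) + C * √(n : ℝ) + E * (√(2 : ℝ) * √(n : ℝ))) :
    f x = A + B * f ⟨√2, sqrt_two_mem⟩ + C * f ⟨√(n : ℝ), sqrt_mem⟩ +
      E * (f ⟨√2, sqrt_two_mem⟩ * f ⟨√(n : ℝ), sqrt_mem⟩) := by
  have : x = (A : biquad n) + B * ⟨√2, sqrt_two_mem⟩ + C * ⟨√(n : ℝ), sqrt_mem⟩ +
      E * (⟨√2, sqrt_two_mem⟩ * ⟨√(n : ℝ), sqrt_mem⟩) := by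
    ext; simpa using h
  conv_lhs => rw [this]
  simp only [map_add, map_mul, map_ratCast]

theorem sq_eq_natCast (h2 : Irrational √(2 : ℝ)) (hn : Irrational √(n : ℝ))
    (h2n : Irrational √((2 * n : ℕ) : ℝ)) {x : ℝ} (hx : x ∈ biquad n) {N : ℕ} (hN : x ^ 2 = N) :
    ∃ A : ℚ, A ^ 2 = N ∨ 2 * A ^ 2 = N ∨ n * A ^ 2 = N ∨ 2 * n * A ^ 2 = N := by
  obtain ⟨σ, τ, hσs, hσr, hτs, hτr⟩ := exists_homs h2 hn h2n
  obtain ⟨A, B, C, E, hc⟩ := exists_coords hx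
  have cσ := map_coords σ (x := ⟨x, hx⟩) hc
  have cτ := map_coords τ (x := ⟨x, hx⟩) hc
  rw [hσs, hσr] at cσ
  rw [hτs, hτr] at cτ
  have hs2 : √(2 : ℝ) ^ 2 = 2 := Real.sq_sqrt zero_le_two
  have hr2 : √(n : ℝ) ^ 2 = n := Real.sq_sqrt (Nat.cast_nonneg n)
  have hr0 : √(n : ℝ) ≠ 0 := hn.ne_zero
  have hx' : (⟨x, hx⟩ : biquad n) ^ 2 = (N : biquad n) := by ext; simpa using hN
  have key : ∀ f : biquad n →+* ℝ, f ⟨x, hx⟩ = x ∨ f ⟨x, hx⟩ = -x := by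
    intro f
    rw [← sq_eq_sq_iff_eq_or_eq_neg, ← map_pow, hx', map_natCast, hN]
  have zero_of : ∀ {a b : ℚ}, (a + b * √2 : ℝ) = 0 → a = 0 ∧ b = 0 := by
    intro a b hab
    have hb : b = 0 := by
      by_contra hb
      refine h2 ⟨-a / b, ?_⟩
      have : (b : ℝ) ≠ 0 := by exact_mod_cast hb
      push_cast
      rw [div_eq_iff this]; linear_combination -hab
    subst hb
    exact ⟨by simpa using hab, rfl⟩
  have zero_of_r : ∀ {a b : ℚ}, (a + b * √(n : ℝ) : ℝ) = 0 → a = 0 ∧ b = 0 := by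
    intro a b hab
    have hb : b = 0 := by
      by_contra hb
      refine hn ⟨-a / b, ?_⟩
      have : (b : ℝ) ≠ 0 := by exact_mod_cast hb
      push_cast
      rw [div_eq_iff this]; linear_combination -hab
    subst hb
    exact ⟨by simpa using hab, rfl⟩
  have hs0 : √(2 : ℝ) ≠ 0 := h2.ne_zero
  have cast : ∀ {a : ℚ}, (a : ℝ) = N → a = N := by intro a h; exact_mod_cast h
  rcases key σ with hσ | hσ <;> rcases key τ with hτ | hτ
  · rw [cσ, hc] at hσ
    rw [cτ, hc] at hτ
    obtain ⟨rfl, rfl⟩ := zero_of (a := C) (b := E) (mul_right_cancel₀ hr0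
      (by linear_combination -hσ / 2))
    obtain ⟨rfl, -⟩ := zero_of_r (a := B) (b := 0) (mul_right_cancel₀ hs0
      (by push_cast; linear_combination -hτ / 2))
    refine ⟨A, Or.inl (cast ?_)⟩
    rw [← hN, hc]; push_cast; ring
  · rw [cσ, hc] at hσ
    rw [cτ, hc] at hτ
    obtain ⟨rfl, rfl⟩ := zero_of (a := C) (b := E) (mul_right_cancel₀ hr0
      (by linear_combination -hσ / 2))
    obtain ⟨rfl, -⟩ := zero_of_r (a := A) (b := 0) (by push_cast at hτ ⊢; linear_combination hτ / 2)
    refine ⟨B, Or.inr (Or.inl (cast ?_))⟩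
    rw [← hN, hc]; push_cast; linear_combination -(B : ℝ) ^ 2 * hs2
  · rw [cσ, hc] at hσ
    rw [cτ, hc] at hτ
    obtain ⟨rfl, rfl⟩ := zero_of (a := A) (b := B) (by linear_combination hσ / 2)
    obtain ⟨-, rfl⟩ := zero_of_r (a := 0) (b := E) (mul_right_cancel₀ hs0
      (by push_cast; linear_combination -hτ / 2))
    refine ⟨C, Or.inr (Or.inr (Or.inl (cast ?_)))⟩
    rw [← hN, hc]; push_cast; linear_combination -(C : ℝ) ^ 2 * hr2
  · rw [cσ, hc] at hσ
    rw [cτ, hc] at hτ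
    obtain ⟨rfl, rfl⟩ := zero_of (a := A) (b := B) (by linear_combination hσ / 2)
    obtain ⟨-, rfl⟩ := zero_of_r (a := 0) (b := C) (by push_cast at hτ ⊢; linear_combination hτ / 2)
    refine ⟨E, Or.inr (Or.inr (Or.inr (cast ?_)))⟩
    rw [← hN, hc]; push_cast
    linear_combination -(E : ℝ) ^ 2 * (√(n : ℝ) ^ 2 * hs2 + 2 * hr2)

end biquad

namespace biquad

variable {n : ℕ}

/-- A pair of generators of the Galois group of `ℚ(√2, √n)`, evaluated on the elements used. -/
theorem exists_homs_spec (hn : Squarefree n) (hn1 : n ≠ 1) (hodd : Odd n) {ε₂ ε₁ ε₃ : ℝ}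
    (h₂ : IsFundUnit 2 ε₂) (h₁ : IsFundUnit n ε₁) (h₃ : IsFundUnit (2 * n) ε₃)
    (m₂ : ε₂ ∈ biquad n) (m₁ : ε₁ ∈ biquad n) (m₃ : ε₃ ∈ biquad n) :
    ∃ σ τ : biquad n →+* ℝ,
      (σ ⟨√2, sqrt_two_mem⟩ = √2 ∧ τ ⟨√2, sqrt_two_mem⟩ = -√2) ∧
      (∀ a, a * σ a ∈ ℚ⟮√((2 : ℕ) : ℝ)⟯) ∧ (∀ a, a * τ a ∈ ℚ⟮√(n : ℝ)⟯) ∧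
      (∀ a, σ a * τ a ∈ ℚ⟮√((2 * n : ℕ) : ℝ)⟯) ∧
      (∀ a : biquad n, (a : ℝ) ∈ ℚ⟮√(n : ℝ)⟯ → τ a = a) ∧
      σ ⟨ε₂, m₂⟩ = ε₂ ∧ τ ⟨ε₁, m₁⟩ = ε₁ ∧ τ ⟨ε₂, m₂⟩ < 0 ∧ τ ⟨ε₃, m₃⟩ = σ ⟨ε₃, m₃⟩ := by
  have hs2 : √(2 : ℝ) ^ 2 = 2 := Real.sq_sqrt zero_le_two
  have hr2 : √(n : ℝ) ^ 2 = n := Real.sq_sqrt (Nat.cast_nonneg n)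
  have i2 : Irrational √(2 : ℝ) := irrational_sqrt_two
  have i1 := irrational_sqrt_of_squarefree hn hn1
  have i3 := irrational_sqrt_of_squarefree (D := 2 * n)
    (Nat.squarefree_mul_iff.2 ⟨by simpa using hodd, Nat.prime_two.squarefree, hn⟩) (by omega)
  obtain ⟨σ, τ, hσs, hσr, hτs, hτr⟩ := exists_homs i2 i1 i3
  have hd : √((2 * n : ℕ) : ℝ) = √2 * √(n : ℝ) := by
    push_cast; exact Real.sqrt_mul zero_le_two _
  refine ⟨σ, τ, ⟨hσs, hτs⟩, ?_, ?_, ?_, ?_, ?_, ?_, ?_, ?_⟩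
  · intro a
    obtain ⟨A, B, C, E, hc⟩ := exists_coords a.2
    have cσ := map_coords σ hc
    rw [hσs, hσr] at cσ
    have := ratCast_add_mul_sqrt_mem 2 (A ^ 2 + 2 * B ^ 2 - n * C ^ 2 - 2 * n * E ^ 2)
      (2 * A * B - 2 * n * C * E)
    convert this using 1
    rw [cσ, hc]
    push_cast
    linear_combination ((B : ℝ) ^ 2 - (E : ℝ) ^ 2 * √(n : ℝ) ^ 2) * hs2 -
      ((C : ℝ) ^ 2 + 2 * C * E * √2 + 2 * (E : ℝ) ^ 2) * hr2
  · intro a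
    obtain ⟨A, B, C, E, hc⟩ := exists_coords a.2
    have cτ := map_coords τ hc
    rw [hτs, hτr] at cτ
    have := ratCast_add_mul_sqrt_mem n (A ^ 2 - 2 * B ^ 2 + n * C ^ 2 - 2 * n * E ^ 2)
      (2 * A * C - 4 * B * E)
    convert this using 1
    rw [cτ, hc]
    push_cast
    linear_combination -((B : ℝ) ^ 2 + 2 * B * E * √(n : ℝ) + (E : ℝ) ^ 2 * √(n : ℝ) ^ 2) * hs2 +
      ((C : ℝ) ^ 2 - 2 * (E : ℝ) ^ 2) * hr2
  · intro a
    obtain ⟨A, B, C, E, hc⟩ := exists_coords a.2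
    have cσ := map_coords σ hc
    have cτ := map_coords τ hc
    rw [hσs, hσr] at cσ
    rw [hτs, hτr] at cτ
    have := ratCast_add_mul_sqrt_mem (2 * n) (A ^ 2 - 2 * B ^ 2 - n * C ^ 2 + 2 * n * E ^ 2)
      (2 * B * C - 2 * A * E)
    convert this using 1
    rw [cσ, cτ, hd]
    push_cast
    linear_combination (-(B : ℝ) ^ 2 + (E : ℝ) ^ 2 * √(n : ℝ) ^ 2) * hs2 +
      (-(C : ℝ) ^ 2 + 2 * (E : ℝ) ^ 2) * hr2
  · intro a ha
    obtain ⟨A, B, h⟩ := exists_ratCast_add_mul_sqrt ha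
    have := map_coords τ (x := a) (A := A) (B := 0) (C := B) (E := 0) (by rw [h]; push_cast; ring)
    rw [this, hτs, hτr, h]; push_cast; ring
  · have e := h₂.eq_one_add_sqrt_two
    have := map_coords σ (x := ⟨ε₂, m₂⟩) (A := 1) (B := 1) (C := 0) (E := 0) (by simp [e])
    rw [this, hσs, e]; push_cast; ring
  · obtain ⟨x, y, -, -, e, -⟩ := h₁.exists_int
    have := map_coords τ (x := ⟨ε₁, m₁⟩) (A := x / 2) (B := 0) (C := y / 2) (E := 0)
      (by simp [e]; ring)
    rw [this, hτs, hτr, e]; push_cast; ring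
  · have e := h₂.eq_one_add_sqrt_two
    have := map_coords τ (x := ⟨ε₂, m₂⟩) (A := 1) (B := 1) (C := 0) (E := 0) (by simp [e])
    rw [this, hτs]
    have : 1 < √(2 : ℝ) := by rw [Real.lt_sqrt] <;> norm_num
    push_cast; linarith
  · obtain ⟨x, y, -, -, e, -⟩ := h₃.exists_int
    rw [hd] at e
    have := map_coords τ (x := ⟨ε₃, m₃⟩) (A := x / 2) (B := 0) (C := 0) (E := y / 2)
      (by push_cast; rw [e]; ring)
    rw [this]
    have := map_coords σ (x := ⟨ε₃, m₃⟩) (A := x / 2) (B := 0) (C := 0) (E := y / 2)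
      (by push_cast; rw [e]; ring)
    rw [this, hτs, hτr, hσs, hσr]; push_cast; ring

theorem zpow_mul_zpow_pos_even {x y : ℝ} (hx : x < 0) (hy : y < 0) {i j : ℤ}
    (h : 0 < x ^ i * y ^ j) : Even (i + j) := by
  rcases Int.even_or_odd i with hi | hi <;> rcases Int.even_or_odd j with hj | hj
  · exact hi.add hj
  · exact absurd h (not_lt.2 (mul_neg_of_pos_of_neg (hi.zpow_pos hx.ne) (hj.zpow_neg hy)).le)
  · exact absurd h (not_lt.2 (mul_neg_of_neg_of_pos (hi.zpow_neg hx) (hj.zpow_pos hy.ne)).le)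
  · exact hi.add_odd hj

/-- If the product of the three fundamental units is a square in `ℚ(√2, √n)`, then `p` times a
unit is neither a square nor `2 + √2` times a square there. -/
theorem false_of_unit (hn : Squarefree n) (hn1 : n ≠ 1) (hodd : Odd n) {ε₂ ε₁ ε₃ : ℝ}
    (h₂ : IsFundUnit 2 ε₂) (h₁ : IsFundUnit n ε₁) (h₃ : IsFundUnit (2 * n) ε₃)
    {p : ℕ} (hp0 : p ≠ 0) (hp : ∀ x ∈ biquad n, x ^ 2 ≠ p)
    {t : ℝ} (ht : t ∈ biquad n) (htsq : t ^ 2 = ε₂ * ε₁ * ε₃)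
    {u : ℝ} (hu : u ∈ biquad n) (hunit : IsIntUnit u) {a : ℝ} (ha : a ∈ biquad n)
    (hau : p * u = a ^ 2 ∨ p * u = (2 + √2) * a ^ 2) : False := by
  have hsf2 : Squarefree (2 * n) :=
    Nat.squarefree_mul_iff.2 ⟨by simpa using hodd, Nat.prime_two.squarefree, hn⟩
  have m₂ : ε₂ ∈ biquad n := adjoin_sqrt_two_le (by exact_mod_cast h₂.mem)
  have m₁ : ε₁ ∈ biquad n := adjoin_sqrt_le h₁.mem
  have m₃ : ε₃ ∈ biquad n := adjoin_sqrt_two_mul_le h₃.mem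
  have p₂ := h₂.pos
  have p₁ := h₁.pos
  have p₃ := h₃.pos
  obtain ⟨σ, τ, ⟨hσs, hτs⟩, N₂, N₁, N₃, hfix, σ₂, τ₁, τ₂, τ₃⟩ :=
    exists_homs_spec hn hn1 hodd h₂ h₁ h₃ m₂ m₁ m₃
  have hpR : (0 : ℝ) < p := by exact_mod_cast Nat.pos_of_ne_zero hp0
  have htne : t ≠ 0 := by
    rintro rfl
    have : 0 < ε₂ * ε₁ * ε₃ := by positivity
    rw [← htsq] at this; simp at this
  have htsq' : (⟨t, ht⟩ : biquad n) ^ 2 = ⟨ε₂, m₂⟩ * ⟨ε₁, m₁⟩ * ⟨ε₃, m₃⟩ := by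
    ext; exact htsq
  have ht0 : (⟨t, ht⟩ : biquad n) ≠ 0 := fun h => htne (congrArg Subtype.val h)
  have σ₃ : σ ⟨ε₃, m₃⟩ < 0 := by
    have h := congrArg τ htsq'
    rw [map_pow, map_mul, map_mul, τ₁, τ₃] at h
    have h0 : 0 < τ ⟨t, ht⟩ ^ 2 := by
      have := (map_ne_zero τ).2 ht0; positivity
    rw [h] at h0
    by_contra hc
    push Not at hc
    have := mul_nonpos_of_nonpos_of_nonneg (mul_neg_of_neg_of_pos τ₂ p₁).le hc
    linarith
  have σ₁ : σ ⟨ε₁, m₁⟩ < 0 := by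
    have h := congrArg σ htsq'
    rw [map_pow, map_mul, map_mul, σ₂] at h
    have h0 : 0 < σ ⟨t, ht⟩ ^ 2 := by
      have := (map_ne_zero σ).2 ht0; positivity
    rw [h] at h0
    by_contra hc
    push Not at hc
    have := mul_nonpos_of_nonneg_of_nonpos (mul_nonneg p₂.le hc) σ₃.le
    linarith
  have hune : u ≠ 0 := hunit.1
  have hune' : (⟨u, hu⟩ : biquad n) ≠ 0 := fun h => hune (congrArg Subtype.val h)
  have hunit' : IsIntUnit (⟨u, hu⟩ : biquad n) :=
    IsIntUnit.of_map (algebraMap (biquad n) ℝ) hunit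
  have uσ := hunit'.map σ
  have uτ := hunit'.map τ
  have hane : a ≠ 0 := by
    rintro rfl
    rcases hau with h | h <;> simp [hp0, hune] at h
  have hane' : (⟨a, ha⟩ : biquad n) ≠ 0 := fun h => hane (congrArg Subtype.val h)
  set α : biquad n := ⟨a, ha⟩ with hα
  have σα : 0 < σ α ^ 2 := by have := (map_ne_zero σ).2 hane'; positivity
  have τα : 0 < τ α ^ 2 := by have := (map_ne_zero τ).2 hane'; positivity
  rcases hau with hau | hau
  · have hau' : (p : biquad n) * ⟨u, hu⟩ = α ^ 2 := by ext; simpa [hα] using hau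
    have hσu : p * σ ⟨u, hu⟩ = σ α ^ 2 := by rw [← map_pow, ← hau', map_mul, map_natCast]
    have hτu : p * τ ⟨u, hu⟩ = τ α ^ 2 := by rw [← map_pow, ← hau', map_mul, map_natCast]
    obtain ⟨i, hi⟩ := h₂.exists_zpow_or Nat.prime_two.squarefree (by norm_num)
      (u := a * σ α / p) (div_mem (N₂ α) (_root_.natCast_mem _ p)) (IsIntUnit.of_sq (by
        have : (a * σ α / p) ^ 2 = u * σ ⟨u, hu⟩ := by
          rw [div_pow, mul_pow, ← hau, ← hσu]; field_simp
        rw [this]; exact hunit.mul uσ))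
    obtain ⟨j, hj⟩ := h₁.exists_zpow_or hn hn1
      (u := a * τ α / p) (div_mem (N₁ α) (_root_.natCast_mem _ p)) (IsIntUnit.of_sq (by
        have : (a * τ α / p) ^ 2 = u * τ ⟨u, hu⟩ := by
          rw [div_pow, mul_pow, ← hau, ← hτu]; field_simp
        rw [this]; exact hunit.mul uτ))
    obtain ⟨k, hk⟩ := h₃.exists_zpow_or hsf2 (by omega)
      (u := σ α * τ α / p) (div_mem (N₃ α) (_root_.natCast_mem _ p)) (IsIntUnit.of_sq (by
        have : (σ α * τ α / p) ^ 2 = σ ⟨u, hu⟩ * τ ⟨u, hu⟩ := by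
          rw [div_pow, mul_pow, ← hσu, ← hτu]; field_simp
        rw [this]; exact uσ.mul uτ))
    have main : a ^ 2 * ε₃ ^ k = p * (ε₂ ^ i * ε₁ ^ j) := by
      rw [← hi, ← hj, ← hk, ← abs_mul]
      have h1 : a * σ α / p * (a * τ α / p) = a ^ 2 * (σ α * τ α / p) / p := by field_simp
      have h2 : |a ^ 2 * (σ α * τ α / p) / p| = a ^ 2 * |σ α * τ α / p| / p := by
        rw [abs_div, abs_mul, abs_of_nonneg (sq_nonneg a), abs_of_pos hpR]
      rw [h1, h2]
      field_simp
    have main' : α ^ 2 * (⟨ε₃, m₃⟩ : biquad n) ^ k =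
        p * ((⟨ε₂, m₂⟩ : biquad n) ^ i * (⟨ε₁, m₁⟩ : biquad n) ^ j) := by
      apply (algebraMap (biquad n) ℝ).injective
      simp only [map_mul, map_pow, map_zpow₀, map_natCast]
      exact main
    have even₁ : Even (k + j) := by
      have h := congrArg σ main'
      simp only [map_mul, map_pow, map_zpow₀, map_natCast] at h
      rw [σ₂] at h
      apply zpow_mul_zpow_pos_even σ₃ σ₁
      have hp2 := zpow_pos p₂ i
      have hsq : 0 < (σ ⟨ε₁, m₁⟩ ^ j) ^ 2 := by
        have := zpow_ne_zero j σ₁.ne; positivity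
      have e : σ α ^ 2 * (σ ⟨ε₃, m₃⟩ ^ k * σ ⟨ε₁, m₁⟩ ^ j) =
          p * ε₂ ^ i * (σ ⟨ε₁, m₁⟩ ^ j) ^ 2 := by linear_combination (σ ⟨ε₁, m₁⟩ ^ j) * h
      have : 0 < σ α ^ 2 * (σ ⟨ε₃, m₃⟩ ^ k * σ ⟨ε₁, m₁⟩ ^ j) := by rw [e]; positivity
      exact pos_of_mul_pos_right this σα.le
    have even₂ : Even (k + i) := by
      have h := congrArg τ main'
      simp only [map_mul, map_pow, map_zpow₀, map_natCast] at h
      rw [τ₁, τ₃] at h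
      apply zpow_mul_zpow_pos_even σ₃ τ₂
      have hp2 := zpow_pos p₁ j
      have hsq : 0 < (τ ⟨ε₂, m₂⟩ ^ i) ^ 2 := by
        have := zpow_ne_zero i τ₂.ne; positivity
      have e : τ α ^ 2 * (σ ⟨ε₃, m₃⟩ ^ k * τ ⟨ε₂, m₂⟩ ^ i) =
          p * ε₁ ^ j * (τ ⟨ε₂, m₂⟩ ^ i) ^ 2 := by linear_combination (τ ⟨ε₂, m₂⟩ ^ i) * h
      have : 0 < τ α ^ 2 * (σ ⟨ε₃, m₃⟩ ^ k * τ ⟨ε₂, m₂⟩ ^ i) := by rw [e]; positivity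
      exact pos_of_mul_pos_right this τα.le
    rcases Int.even_or_odd k with hk2 | hk2
    · obtain ⟨i', rfl⟩ := (Int.even_add.1 even₂).1 hk2
      obtain ⟨j', rfl⟩ := (Int.even_add.1 even₁).1 hk2
      obtain ⟨k', rfl⟩ := hk2
      refine hp (a * ε₃ ^ k' / (ε₂ ^ i' * ε₁ ^ j')) (div_mem (mul_mem ha (zpow_mem m₃ _))
        (mul_mem (zpow_mem m₂ _) (zpow_mem m₁ _))) ?_
      rw [zpow_add₀ p₃.ne', zpow_add₀ p₂.ne', zpow_add₀ p₁.ne'] at main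
      rw [div_pow, div_eq_iff (by positivity)]
      linear_combination main
    · have hi2 : Odd i := by
        rw [← Int.not_even_iff_odd] at hk2 ⊢; rwa [← Int.even_add.1 even₂]
      have hj2 : Odd j := by
        rw [← Int.not_even_iff_odd] at hk2 ⊢; rwa [← Int.even_add.1 even₁]
      obtain ⟨i', rfl⟩ := hi2
      obtain ⟨j', rfl⟩ := hj2
      obtain ⟨k', rfl⟩ := hk2
      refine hp (a * ε₃ ^ k' * ε₃ / (t * (ε₂ ^ i' * ε₁ ^ j'))) (div_mem
        (mul_mem (mul_mem ha (zpow_mem m₃ _)) m₃)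
        (mul_mem ht (mul_mem (zpow_mem m₂ _) (zpow_mem m₁ _)))) ?_
      rw [zpow_add_one₀ p₃.ne', zpow_add_one₀ p₂.ne', zpow_add_one₀ p₁.ne', two_mul, two_mul,
        two_mul, zpow_add₀ p₃.ne', zpow_add₀ p₂.ne', zpow_add₀ p₁.ne'] at main
      rw [div_pow, div_eq_iff (by positivity), mul_pow t, htsq]
      linear_combination ε₃ * main
  · have hau' : (p : biquad n) * ⟨u, hu⟩ = (2 + ⟨√2, sqrt_two_mem⟩) * α ^ 2 := by
      apply (algebraMap (biquad n) ℝ).injective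
      simp only [map_mul, map_natCast, map_add, map_ofNat, map_pow]
      exact hau
    have hτu : p * τ ⟨u, hu⟩ = (2 - √2) * τ α ^ 2 := by
      have := congrArg τ hau'
      rw [map_mul, map_mul, map_natCast, map_add, map_ofNat, map_pow, hτs] at this
      rw [this]; ring
    have hs2 : √(2 : ℝ) ^ 2 = 2 := Real.sq_sqrt zero_le_two
    have hv : p ^ 2 * (u * τ ⟨u, hu⟩) = 2 * (a * τ α) ^ 2 := by
      linear_combination p * τ ⟨u, hu⟩ * hau + (2 + √2) * a ^ 2 * hτu - a ^ 2 * τ α ^ 2 * hs2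
    have hvmem : u * τ ⟨u, hu⟩ ∈ ℚ⟮√(n : ℝ)⟯ := N₁ ⟨u, hu⟩
    have hypos : 0 < (a * τ α) ^ 2 := by
      have := (map_ne_zero τ).2 hane'; positivity
    have hvpos : 0 < u * τ ⟨u, hu⟩ :=
      pos_of_mul_pos_right (by rw [hv]; positivity) (sq_nonneg (p : ℝ))
    obtain ⟨j, hj⟩ := h₁.exists_zpow hn hn1 hvmem (hunit.mul uτ) hvpos
    have hymem : a * τ α ∈ ℚ⟮√(n : ℝ)⟯ := N₁ α
    have hj2 : Even j := by
      have h' : (p : biquad n) ^ 2 * (⟨ε₁, m₁⟩ : biquad n) ^ j =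
          2 * (⟨a * τ α, adjoin_sqrt_le hymem⟩ : biquad n) ^ 2 := by
        apply (algebraMap (biquad n) ℝ).injective
        simp only [map_mul, map_pow, map_zpow₀, map_natCast, map_ofNat]
        rw [hj] at hv
        exact hv
      have h := congrArg σ h'
      simp only [map_mul, map_pow, map_zpow₀, map_natCast, map_ofNat] at h
      by_contra hc
      rw [Int.not_even_iff_odd] at hc
      have h1 := hc.zpow_neg σ₁
      have h2 : (p : ℝ) ^ 2 * σ ⟨ε₁, m₁⟩ ^ j < 0 := mul_neg_of_pos_of_neg (by positivity) h1
      rw [h] at h2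
      linarith [sq_nonneg (σ ⟨a * τ α, adjoin_sqrt_le hymem⟩)]
    obtain ⟨j', rfl⟩ := hj2
    rw [zpow_add₀ p₁.ne'] at hj
    have hyne : a * τ α ≠ 0 := fun h => by rw [h] at hypos; simp at hypos
    have hz : (p * ε₁ ^ j' / (a * τ α)) ^ 2 = √2 ^ 2 := by
      rw [hs2, div_pow, div_eq_iff hypos.ne']
      rw [hj] at hv
      linear_combination hv
    have hzmem : p * ε₁ ^ j' / (a * τ α) ∈ ℚ⟮√(n : ℝ)⟯ :=
      div_mem (mul_mem (_root_.natCast_mem _ p) (zpow_mem h₁.mem _)) hymem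
    have hcon : √(2 : ℝ) ∈ ℚ⟮√(n : ℝ)⟯ := by
      rcases sq_eq_sq_iff_eq_or_eq_neg.1 hz with h | h
      · rwa [← h]
      · rw [← neg_neg √(2 : ℝ), ← h]; exact neg_mem hzmem
    have := hfix ⟨√2, sqrt_two_mem⟩ hcon
    rw [hτs] at this
    have hpos : 0 < √(2 : ℝ) := by positivity
    simp only at this
    linarith

end biquad

open scoped ComplexConjugate

/-- The field `ℚ(√2, √n, i)`. -/
noncomputable def biquadI (n : ℕ) : IntermediateField ℚ ℂ :=
  ℚ⟮((√(2 : ℝ) : ℝ) : ℂ), ((√(n : ℝ) : ℝ) : ℂ), Complex.I⟯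

namespace biquadI

open Complex

variable {n : ℕ}

theorem sqrt_two_mem : ((√(2 : ℝ) : ℝ) : ℂ) ∈ biquadI n := subset_adjoin _ _ (by simp)

theorem sqrt_mem : ((√(n : ℝ) : ℝ) : ℂ) ∈ biquadI n := subset_adjoin _ _ (by simp)

theorem I_mem : I ∈ biquadI n := subset_adjoin _ _ (by simp)

theorem ofReal_mem {x : ℝ} (hx : x ∈ biquad n) : (x : ℂ) ∈ biquadI n := by
  obtain ⟨A, B, C, E, rfl⟩ := biquad.exists_coords hx
  have h : ∀ q : ℚ, (q : ℂ) ∈ biquadI n := fun q => SubfieldClass.ratCast_mem _ q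
  push_cast
  exact add_mem (add_mem (add_mem (h A) (mul_mem (h B) sqrt_two_mem)) (mul_mem (h C) sqrt_mem))
    (mul_mem (h E) (mul_mem sqrt_two_mem sqrt_mem))

theorem re_im_mem {z : ℂ} (hz : z ∈ biquadI n) : z.re ∈ biquad n ∧ z.im ∈ biquad n := by
  induction hz using adjoin_induction with
  | mem x hx =>
    rcases hx with rfl | rfl | rfl
    · exact ⟨biquad.sqrt_two_mem, zero_mem _⟩
    · exact ⟨biquad.sqrt_mem, zero_mem _⟩
    · exact ⟨zero_mem _, one_mem _⟩
  | algebraMap x =>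
    rw [eq_ratCast]
    exact ⟨by rw [ratCast_re]; exact SubfieldClass.ratCast_mem _ x,
      by rw [ratCast_im]; exact zero_mem _⟩
  | add x y _ _ hx hy => exact ⟨add_mem hx.1 hy.1, add_mem hx.2 hy.2⟩
  | inv x _ hx =>
    have hN : normSq x ∈ biquad n := by
      rw [normSq_apply]; exact add_mem (mul_mem hx.1 hx.1) (mul_mem hx.2 hx.2)
    rw [inv_re, inv_im]
    exact ⟨div_mem hx.1 hN, div_mem (neg_mem hx.2) hN⟩
  | mul x y _ _ hx hy =>
    rw [mul_re, mul_im]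
    exact ⟨sub_mem (mul_mem hx.1 hy.1) (mul_mem hx.2 hy.2),
      add_mem (mul_mem hx.1 hy.2) (mul_mem hx.2 hy.1)⟩

theorem mem_of_re_im {z : ℂ} (hr : z.re ∈ biquad n) (hi : z.im ∈ biquad n) : z ∈ biquadI n := by
  rw [← re_add_im z]
  exact add_mem (ofReal_mem hr) (mul_mem (ofReal_mem hi) I_mem)

theorem mem_biquad_of_ofReal_mem {x : ℝ} (hx : (x : ℂ) ∈ biquadI n) : x ∈ biquad n :=
  (re_im_mem hx).1

theorem conj_mem {z : ℂ} (hz : z ∈ biquadI n) : conj z ∈ biquadI n := by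
  obtain ⟨hr, hi⟩ := re_im_mem hz
  exact mem_of_re_im (by rwa [conj_re]) (by rw [conj_im]; exact neg_mem hi)

/-- Embeddings of `ℚ(√2, √n, i)` commute with complex conjugation. -/
theorem map_conj (φ : biquadI n →+* ℂ) {z : ℂ} (hz : z ∈ biquadI n) :
    φ ⟨conj z, conj_mem hz⟩ = conj (φ ⟨z, hz⟩) := by
  have key : ∀ (m : ℕ) (hm : ((√(m : ℝ) : ℝ) : ℂ) ∈ biquadI n),
      φ ⟨conj ((√(m : ℝ) : ℝ) : ℂ), conj_mem hm⟩ = conj (φ ⟨((√(m : ℝ) : ℝ) : ℂ), hm⟩) := by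
    intro m hm
    have e : φ ⟨((√(m : ℝ) : ℝ) : ℂ), hm⟩ ^ 2 = ((√(m : ℝ) : ℝ) : ℂ) ^ 2 := by
      have h1 : ((√(m : ℝ) : ℝ) : ℂ) ^ 2 = m := by
        rw [← ofReal_pow, Real.sq_sqrt (Nat.cast_nonneg m), ofReal_natCast]
      rw [h1, ← map_pow, ← map_natCast φ]
      congr 1
      apply (algebraMap (biquadI n) ℂ).injective
      rw [map_pow, map_natCast]
      exact h1
    have e2 : (⟨conj ((√(m : ℝ) : ℝ) : ℂ), conj_mem hm⟩ : biquadI n) =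
        ⟨((√(m : ℝ) : ℝ) : ℂ), hm⟩ := Subtype.ext (conj_ofReal _)
    rw [e2]
    rcases sq_eq_sq_iff_eq_or_eq_neg.1 e with h | h <;> rw [h] <;> simp
  induction hz using adjoin_induction with
  | mem x hx =>
    rcases hx with rfl | rfl | rfl
    · exact_mod_cast key 2 (by exact_mod_cast sqrt_two_mem)
    · exact key n sqrt_mem
    · have e : φ ⟨I, I_mem⟩ ^ 2 = I ^ 2 := by
        rw [I_sq, ← map_one φ, ← map_neg, ← map_pow]
        congr 1
        apply (algebraMap (biquadI n) ℂ).injective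
        rw [map_pow, map_neg, map_one]
        exact I_sq
      have e2 : (⟨conj I, conj_mem I_mem⟩ : biquadI n) = -⟨I, I_mem⟩ := Subtype.ext conj_I
      rw [e2, map_neg]
      rcases sq_eq_sq_iff_eq_or_eq_neg.1 e with h | h <;> rw [h] <;> simp
  | algebraMap x =>
    have : ∀ h : algebraMap ℚ ℂ x ∈ biquadI n, (⟨algebraMap ℚ ℂ x, h⟩ : biquadI n) = (x : ℚ) :=
      fun h => Subtype.ext (by simp)
    have e : conj (algebraMap ℚ ℂ x) = algebraMap ℚ ℂ x := by simp
    simp only [e]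
    rw [this, map_ratCast, map_ratCast]
  | add x y hx hy h1 h2 =>
    have e1 : (⟨conj (x + y), conj_mem (add_mem hx hy)⟩ : biquadI n) =
      ⟨conj x, conj_mem hx⟩ + ⟨conj y, conj_mem hy⟩ := Subtype.ext (map_add _ _ _)
    have e2 : (⟨x + y, add_mem hx hy⟩ : biquadI n) = ⟨x, hx⟩ + ⟨y, hy⟩ := rfl
    rw [e1, e2, map_add, map_add, map_add, h1, h2]
  | inv x hx h1 =>
    have e1 : (⟨conj x⁻¹, conj_mem (inv_mem hx)⟩ : biquadI n) = (⟨conj x, conj_mem hx⟩)⁻¹ :=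
      Subtype.ext (map_inv₀ _ _)
    have e2 : (⟨x⁻¹, inv_mem hx⟩ : biquadI n) = (⟨x, hx⟩)⁻¹ := rfl
    rw [e1, e2, map_inv₀, map_inv₀, map_inv₀, h1]
  | mul x y hx hy h1 h2 =>
    have e1 : (⟨conj (x * y), conj_mem (mul_mem hx hy)⟩ : biquadI n) =
      ⟨conj x, conj_mem hx⟩ * ⟨conj y, conj_mem hy⟩ := Subtype.ext (map_mul _ _ _)
    have e2 : (⟨x * y, mul_mem hx hy⟩ : biquadI n) = ⟨x, hx⟩ * ⟨y, hy⟩ := rfl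
    rw [e1, e2, map_mul, map_mul, map_mul, h1, h2]

theorem norm_map_eq_one (φ : biquadI n →+* ℂ) {z : biquadI n} (hz : (z : ℂ) * conj (z : ℂ) = 1) :
    ‖φ z‖ = 1 := by
  have h := map_conj φ z.2
  have e : z * ⟨conj (z : ℂ), conj_mem z.2⟩ = 1 := Subtype.ext hz
  have := congrArg φ e
  rw [map_mul, map_one, h, mul_conj, normSq_eq_norm_sq] at this
  have h2 : ‖φ z‖ ^ 2 = 1 := by exact_mod_cast this
  exact (pow_eq_one_iff_of_nonneg (norm_nonneg _) two_ne_zero).1 h2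

instance : NumberField (biquadI n) where
  to_charZero := inferInstance
  to_finiteDimensional := by
    have h : ∀ m : ℕ, IsIntegral ℚ ((√(m : ℝ) : ℝ) : ℂ) := fun m =>
      IsIntegral.of_pow two_pos (by
        rw [← ofReal_pow, Real.sq_sqrt (Nat.cast_nonneg m), ofReal_natCast]
        exact isIntegral_algebraMap (R := ℚ) (x := (m : ℚ)))
    refine IntermediateField.finiteDimensional_adjoin (K := ℚ) (L := ℂ) ?_
    rintro x (rfl | rfl | rfl)
    · exact_mod_cast h 2
    · exact h n
    · exact IsIntegral.of_pow two_pos (by rw [I_sq]; exact isIntegral_one.neg)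

/-- Integral elements of absolute value one are roots of unity. -/
theorem exists_pow_eq_one {z : ℂ} (hz : z ∈ biquadI n) (hint : IsIntegral ℤ z)
    (h1 : z * conj z = 1) : ∃ m : ℕ, 0 < m ∧ z ^ m = 1 := by
  have hint' : IsIntegral ℤ (⟨z, hz⟩ : biquadI n) :=
    (isIntegral_algHom_iff (algebraMap (biquadI n) ℂ).toIntAlgHom
      (algebraMap (biquadI n) ℂ).injective).1 hint
  obtain ⟨m, hm, h⟩ := NumberField.Embeddings.pow_eq_one_of_norm_eq_one (biquadI n) ℂ hint'
    (fun φ => norm_map_eq_one φ h1)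
  exact ⟨m, hm, congrArg Subtype.val h⟩

end biquadI

namespace biquadI

open Complex

variable {n : ℕ}

theorem pow_eight_ne_neg_one (hn : Squarefree n) (hn1 : n ≠ 1) (hodd : Odd n) {ε₂ ε₁ ε₃ : ℝ}
    (h₂ : IsFundUnit 2 ε₂) (h₁ : IsFundUnit n ε₁) (h₃ : IsFundUnit (2 * n) ε₃)
    {z : ℂ} (hz : z ∈ biquadI n) : z ^ 8 ≠ -1 := by
  intro h8
  obtain ⟨σ, τ, ⟨-, hτs⟩, -, N₁, -, hfix, -⟩ := biquad.exists_homs_spec hn hn1 hodd h₂ h₁ h₃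
    (biquad.adjoin_sqrt_two_le (by exact_mod_cast h₂.mem)) (biquad.adjoin_sqrt_le h₁.mem)
    (biquad.adjoin_sqrt_two_mul_le h₃.mem)
  have hs2 : √(2 : ℝ) ^ 2 = 2 := Real.sq_sqrt zero_le_two
  have hnorm : z * conj z = 1 := by
    have h : ‖z‖ ^ 8 = 1 := by rw [← norm_pow, h8, norm_neg, norm_one]
    rw [mul_conj, normSq_eq_norm_sq, (pow_eq_one_iff_of_nonneg (norm_nonneg _) (by norm_num)).1 h]
    simp
  set w : ℝ := 2 * z.re with hw
  have hwz : (w : ℂ) = z + conj z := by rw [add_conj]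
  have hwL : w ∈ biquad n := mul_mem (ofNat_mem _ 2) (re_im_mem hz).1
  have h4 : z ^ 4 = I ∨ z ^ 4 = -I := by
    rw [← sq_eq_sq_iff_eq_or_eq_neg, I_sq, ← h8]; ring
  have h4' : z ^ 4 + conj z ^ 4 = 0 := by
    rw [← map_pow]
    rcases h4 with h | h <;> rw [h] <;> simp
  have hw2 : (w ^ 2 - 2) ^ 2 = √2 ^ 2 := by
    rw [hs2]
    have : ((w : ℂ) ^ 2 - 2) ^ 2 = 2 := by
      rw [hwz]
      linear_combination h4' + (4 * z ^ 2 + 4 * conj z ^ 2 + 6 * z * conj z - 2) * hnorm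
    exact_mod_cast this
  have key : ∃ c : ℝ, c ^ 2 = 1 ∧ ∃ C : biquad n, (C : ℝ) = c ∧ τ C = c ∧ w ^ 2 - 2 = c * √2 := by
    rcases sq_eq_sq_iff_eq_or_eq_neg.1 hw2 with h | h
    · exact ⟨1, by norm_num, 1, rfl, map_one τ, by rw [h, one_mul]⟩
    · exact ⟨-1, by norm_num, -1, rfl, by rw [map_neg, map_one], by rw [h]; ring⟩
  obtain ⟨c, hc, C, hCc, hτC, hwc⟩ := key
  have e : (⟨w, hwL⟩ : biquad n) ^ 2 - 2 = C * ⟨√2, biquad.sqrt_two_mem⟩ := by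
    apply (algebraMap (biquad n) ℝ).injective
    simp only [map_sub, map_pow, map_mul, map_ofNat]
    change w ^ 2 - 2 = C * √2
    rw [hCc, hwc]
  have e2 := congrArg τ e
  rw [map_sub, map_pow, map_ofNat, map_mul, hτC, hτs] at e2
  have e3 : (w * τ ⟨w, hwL⟩) ^ 2 = √2 ^ 2 := by
    rw [hs2]
    linear_combination (τ ⟨w, hwL⟩) ^ 2 * hwc + (2 + c * √2) * e2 - 2 * hc - c ^ 2 * hs2
  have hcon : √(2 : ℝ) ∈ ℚ⟮√(n : ℝ)⟯ := by
    rcases sq_eq_sq_iff_eq_or_eq_neg.1 e3 with h | h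
    · rw [← h]; exact N₁ ⟨w, hwL⟩
    · rw [← neg_neg √(2 : ℝ), ← h]; exact neg_mem (N₁ ⟨w, hwL⟩)
  have := hfix ⟨√2, biquad.sqrt_two_mem⟩ hcon
  rw [hτs] at this
  have hpos : 0 < √(2 : ℝ) := by positivity
  simp only at this
  linarith

/-- A primitive eighth root of unity. -/
noncomputable def zeta : ℂ := (1 + I) / ((√(2 : ℝ) : ℝ) : ℂ)

theorem zeta_sq : zeta ^ 2 = I := by
  have h : ((√(2 : ℝ) : ℝ) : ℂ) ^ 2 = 2 := by
    rw [← ofReal_pow, Real.sq_sqrt zero_le_two]; norm_num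
  rw [zeta, div_pow, h, div_eq_iff two_ne_zero]
  linear_combination I_sq

theorem zeta_mem : zeta ∈ biquadI n := div_mem (add_mem (one_mem _) I_mem) sqrt_two_mem

theorem zeta_mul_conj : zeta * conj zeta = 1 := by
  have h : ‖zeta‖ ^ 2 = 1 := by rw [← norm_pow, zeta_sq, norm_I]
  rw [mul_conj, normSq_eq_norm_sq, h, ofReal_one]

theorem zeta_add_conj : zeta + conj zeta = ((√(2 : ℝ) : ℝ) : ℂ) := by
  have h : ((√(2 : ℝ) : ℝ) : ℂ) ^ 2 = 2 := by
    rw [← ofReal_pow, Real.sq_sqrt zero_le_two]; norm_num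
  have h0 : ((√(2 : ℝ) : ℝ) : ℂ) ≠ 0 := fun h0 => by rw [h0] at h; norm_num at h
  rw [zeta, map_div₀, conj_ofReal, map_add, map_one, conj_I, ← add_div, div_eq_iff h0]
  linear_combination -h

theorem exists_sq_of_pow_eight_eq_one {ω : ℂ} (h : ω ^ 8 = 1) :
    ∃ κ ∈ biquadI n, ω = κ ^ 2 ∨ ω = zeta * κ ^ 2 := by
  have hz := zeta_sq
  have hI := I_sq
  have mI : I ∈ biquadI n := I_mem
  have mz : zeta ∈ biquadI n := zeta_mem
  rcases _root_.sq_eq_one_iff.1 (by rw [← h]; ring : (ω ^ 4) ^ 2 = 1) with h | h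
  · rcases _root_.sq_eq_one_iff.1 (by rw [← h]; ring : (ω ^ 2) ^ 2 = 1) with h | h
    · rcases _root_.sq_eq_one_iff.1 h with h | h
      · exact ⟨1, one_mem _, Or.inl (by rw [h]; ring)⟩
      · exact ⟨I, mI, Or.inl (by rw [h, hI])⟩
    · rcases sq_eq_sq_iff_eq_or_eq_neg.1 (h.trans hI.symm) with h | h
      · exact ⟨zeta, mz, Or.inl (by rw [h, hz])⟩
      · exact ⟨I * zeta, mul_mem mI mz, Or.inl (by rw [h, mul_pow, hz, hI]; ring)⟩
  · rcases sq_eq_sq_iff_eq_or_eq_neg.1 ((by rw [hI, ← h]; ring : (ω ^ 2) ^ 2 = I ^ 2)) with h | h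
    · rcases sq_eq_sq_iff_eq_or_eq_neg.1 (h.trans hz.symm) with h | h
      · exact ⟨1, one_mem _, Or.inr (by rw [h]; ring)⟩
      · exact ⟨I, mI, Or.inr (by rw [h, hI]; ring)⟩
    · have : ω ^ 2 = (I * zeta) ^ 2 := by rw [h, mul_pow, hz, hI]; ring
      rcases sq_eq_sq_iff_eq_or_eq_neg.1 this with h | h
      · exact ⟨zeta, mz, Or.inr (by rw [h, hz]; ring)⟩
      · exact ⟨I * zeta, mul_mem mI mz, Or.inr (by rw [h, mul_pow, hz, hI]; ring)⟩

theorem exists_sq_of_pow_eq_one (hn : Squarefree n) (hn1 : n ≠ 1) (hodd : Odd n) {ε₂ ε₁ ε₃ : ℝ}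
    (h₂ : IsFundUnit 2 ε₂) (h₁ : IsFundUnit n ε₁) (h₃ : IsFundUnit (2 * n) ε₃)
    {ξ : ℂ} (hξ : ξ ∈ biquadI n) {m : ℕ} (hm : 0 < m) (h : ξ ^ m = 1) :
    ∃ κ ∈ biquadI n, ξ = κ ^ 2 ∨ ξ = zeta * κ ^ 2 := by
  obtain ⟨k, o, ⟨j, rfl⟩, rfl⟩ := Nat.exists_eq_two_pow_mul_odd hm.ne'
  have hξ0 : ξ ≠ 0 := by rintro rfl; rw [zero_pow hm.ne'] at h; exact zero_ne_one h
  have hω : ξ ^ (2 * j + 1) ∈ biquadI n := _root_.pow_mem hξ _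
  have h8 : ∀ k : ℕ, (ξ ^ (2 * j + 1)) ^ 2 ^ k = 1 → (ξ ^ (2 * j + 1)) ^ 8 = 1 := by
    intro k
    induction k with
    | zero => intro h; rw [pow_zero, pow_one] at h; rw [h, one_pow]
    | succ k ih =>
      intro h
      rw [pow_succ 2 k, pow_mul _ (2 ^ k)] at h
      rcases _root_.sq_eq_one_iff.1 h with h | h
      · exact ih h
      · rcases lt_or_ge k 3 with hk | hk
        · have : (8 : ℕ) = 2 ^ k * 2 ^ (2 - k) * 2 := by
            rw [← pow_add, ← pow_succ, show k + (2 - k) + 1 = 3 by omega]; norm_num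
          rw [this, pow_mul, pow_mul, h, ← pow_mul, mul_comm, pow_mul]; norm_num
        · exfalso
          refine pow_eight_ne_neg_one hn hn1 hodd h₂ h₁ h₃
            (_root_.pow_mem hω (2 ^ (k - 3))) ?_
          rw [← pow_mul, ← h]
          congr 1
          rw [show (8 : ℕ) = 2 ^ 3 by norm_num, ← pow_add, Nat.sub_add_cancel hk]
  have := h8 k (by rw [← pow_mul, mul_comm, h])
  obtain ⟨κ, hκ, h'⟩ := exists_sq_of_pow_eight_eq_one (n := n) this
  refine ⟨κ / ξ ^ j, div_mem hκ (_root_.pow_mem hξ _), h'.imp (fun h' => ?_) fun h' => ?_⟩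
  · rw [div_pow, eq_div_iff (by positivity), ← h']; ring
  · rw [div_pow, ← mul_div_assoc, eq_div_iff (by positivity), ← h']; ring

/-- If the product of the three fundamental units is a square in `ℚ(√2, √n)`, then no element of
`ℚ(√2, √n, i)` has a square that is associated to `p`. -/
theorem false_of_sq_div_unit (hn : Squarefree n) (hn1 : n ≠ 1) (hodd : Odd n) {ε₂ ε₁ ε₃ : ℝ}
    (h₂ : IsFundUnit 2 ε₂) (h₁ : IsFundUnit n ε₁) (h₃ : IsFundUnit (2 * n) ε₃)
    {p : ℕ} (hp0 : p ≠ 0) (hp : ∀ x ∈ biquad n, x ^ 2 ≠ p)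
    {t : ℝ} (ht : t ∈ biquad n) (htsq : t ^ 2 = ε₂ * ε₁ * ε₃)
    {α : ℂ} (hα : α ∈ biquadI n) (hunit : IsIntUnit (α ^ 2 / p)) : False := by
  have hα0 : α ≠ 0 := by rintro rfl; exact hunit.1 (by simp)
  have hc0 : conj α ≠ 0 := by simpa using hα0
  have hp0' : (p : ℂ) ≠ 0 := by exact_mod_cast hp0
  have hunit' : IsIntUnit (conj α ^ 2 / p) := by simpa using hunit.map (starRingEnd ℂ)
  have hξ : IsIntUnit (α / conj α) := IsIntUnit.of_sq (by
    have : (α / conj α) ^ 2 = α ^ 2 / p / (conj α ^ 2 / p) := by field_simp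
    rw [this]; exact hunit.div hunit')
  have hξmem : α / conj α ∈ biquadI n := div_mem hα (conj_mem hα)
  have hξ1 : α / conj α * conj (α / conj α) = 1 := by
    rw [map_div₀, conj_conj]; field_simp
  obtain ⟨m, hm, hpow⟩ := exists_pow_eq_one hξmem hξ.2.1 hξ1
  obtain ⟨κ, hκ, hκξ⟩ := exists_sq_of_pow_eq_one hn hn1 hodd h₂ h₁ h₃ hξmem hm hpow
  have hu : IsIntUnit (normSq α / p : ℝ) := by
    apply IsIntUnit.of_map ofRealHom
    apply IsIntUnit.of_sq
    have : ofRealHom (normSq α / p : ℝ) ^ 2 = α ^ 2 / p * (conj α ^ 2 / p) := by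
      rw [ofRealHom_eq_coe, ofReal_div, ← mul_conj, ofReal_natCast]; field_simp
    rw [this]; exact hunit.mul hunit'
  have humem : normSq α / p ∈ biquad n := by
    obtain ⟨hr, hi⟩ := re_im_mem hα
    rw [normSq_apply]
    exact div_mem (add_mem (mul_mem hr hr) (mul_mem hi hi)) (_root_.natCast_mem _ p)
  have hpu : (p : ℝ) * (normSq α / p) = normSq α := by
    have : (p : ℝ) ≠ 0 := by exact_mod_cast hp0
    field_simp
  have hκ1 : κ * conj κ = 1 := by
    have e : normSq κ ^ 2 = 1 := by
      have h1 := congrArg normSq hpow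
      have h2 : normSq (α / conj α) = 1 := by
        rw [← ofReal_inj, ← mul_conj, hξ1, ofReal_one]
      rcases hκξ with h | h
      · rw [← h2, h, map_pow]
      · have h3 : normSq zeta = 1 := by
          rw [← ofReal_inj, ← mul_conj, zeta_mul_conj, ofReal_one]
        rw [← h2, h, map_mul, map_pow, h3, one_mul]
    rw [mul_conj, (pow_eq_one_iff_of_nonneg (normSq_nonneg _) two_ne_zero).1 e, ofReal_one]
  have finish : ∀ {a : ℂ}, a ∈ biquadI n → conj a = a →
      ((normSq α : ℂ) = a ^ 2 ∨ (normSq α : ℂ) = (2 + ((√(2 : ℝ) : ℝ) : ℂ)) * a ^ 2) → False := by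
    intro a ha hreal h
    obtain ⟨r, rfl⟩ := conj_eq_iff_real.1 hreal
    refine biquad.false_of_unit hn hn1 hodd h₂ h₁ h₃ hp0 hp ht htsq humem hu
      (mem_biquad_of_ofReal_mem ha) (h.imp (fun h => ?_) fun h => ?_)
    · rw [hpu]; exact_mod_cast h
    · rw [hpu]; exact_mod_cast h
  rcases hκξ with h | h
  · rw [div_eq_iff hc0] at h
    refine finish (a := α * conj κ) (mul_mem hα (conj_mem hκ)) ?_ (Or.inl ?_)
    · rw [map_mul, conj_conj]
      linear_combination -conj κ * h - conj α * κ * hκ1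
    · rw [← mul_conj]
      linear_combination -α * conj κ ^ 2 * h +  (-α * conj α * (κ * conj κ + 1)) * hκ1
  · rw [div_eq_iff hc0] at h
    have hz1 := zeta_mul_conj
    have hz2 := zeta_add_conj
    have hz : (1 + zeta) * (1 + conj zeta) = 2 + ((√(2 : ℝ) : ℝ) : ℂ) := by
      linear_combination hz1 + hz2
    have hz0 : (1 + zeta) * (1 + conj zeta) ≠ 0 := by
      rw [hz]
      have : (2 + √2 : ℝ) ≠ 0 := by positivity
      exact_mod_cast this
    have hza := left_ne_zero_of_mul hz0
    have hzb := right_ne_zero_of_mul hz0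
    refine finish (a := α * conj κ / (1 + zeta)) (div_mem (mul_mem hα (conj_mem hκ))
      (add_mem (one_mem _) zeta_mem)) ?_ (Or.inr ?_)
    · rw [map_div₀, map_mul, conj_conj, map_add, map_one, div_eq_div_iff hzb hza]
      linear_combination (-conj κ * (1 + conj zeta)) * h -
        conj α * κ * zeta * (1 + conj zeta) * hκ1 - conj α * κ * hz1
    · rw [← mul_conj, ← hz, div_pow, ← mul_div_assoc, eq_div_iff (by positivity)]
      linear_combination -((1 + zeta) * (1 + conj zeta)) * α * conj κ ^ 2 * h -
        (1 + zeta) * (1 + conj zeta) * α * conj α * zeta * (κ * conj κ + 1) * hκ1 -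
        α * conj α * (1 + zeta) * hz1

end biquadI

theorem Squarefree.dvd_of_forall_prime {c N : ℕ} (hc : Squarefree c) (hN : N ≠ 0)
    (h : ∀ ℓ : ℕ, ℓ.Prime → ℓ ∣ c → ℓ ∣ N) : c ∣ N := by
  rw [← Nat.prod_primeFactors_of_squarefree hc]
  refine (Finset.prod_dvd_prod_of_subset _ N.primeFactors _ fun ℓ hℓ => ?_).trans
    (Nat.prod_primeFactors_dvd N)
  have := Nat.prime_of_mem_primeFactors hℓ
  exact Nat.mem_primeFactors.2 ⟨this, h ℓ this (Nat.dvd_of_mem_primeFactors hℓ), hN⟩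

theorem dvd_two_mul_prime_mul_prime {p₁ p₂ c : ℕ} (hp₁ : p₁.Prime) (hp₂ : p₂.Prime)
    (h : c ∣ 2 * (p₁ * p₂)) :
    c = 1 ∨ c = 2 ∨ c = p₁ ∨ c = 2 * p₁ ∨ c = p₂ ∨ c = 2 * p₂ ∨ c = p₁ * p₂ ∨
      c = 2 * (p₁ * p₂) := by
  obtain ⟨a, b, ha, hb, rfl⟩ := (dvd_mul).1 h
  obtain ⟨b₁, b₂, hb₁, hb₂, rfl⟩ := (dvd_mul).1 hb
  rcases (Nat.dvd_prime Nat.prime_two).1 ha with rfl | rfl <;>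
  rcases (Nat.dvd_prime hp₁).1 hb₁ with rfl | rfl <;>
  rcases (Nat.dvd_prime hp₂).1 hb₂ with rfl | rfl <;> simp

/-- A norm form argument: if `x² - D y² = 4`, then the squarefree part of `x + 2` is restricted. -/
theorem exists_mul_sq_of_norm_eq_four {p₁ p₂ D : ℕ} (hp₁ : p₁.Prime) (hp₂ : p₂.Prime)
    (hm₁ : p₁ % 8 = 5) (hsf : Squarefree D) (hD : D = p₁ * p₂ ∨ D = 2 * (p₁ * p₂))
    {x : ℕ} {y : ℤ} (h : (x : ℤ) ^ 2 - D * y ^ 2 = 4) :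
    ∃ c w : ℕ, w ≠ 0 ∧ x + 2 = c * w ^ 2 ∧
      (c = 1 ∨ c = D ∨ c = p₁ ∨ c = 2 * p₁ ∨ c = p₂ ∨ c = 2 * p₂) := by
  obtain ⟨c, w, hcw, hc⟩ := Nat.sq_mul_squarefree (x + 2)
  have hw0 : w ≠ 0 := by rintro rfl; simp at hcw
  have hD0 : D ≠ 0 := hsf.ne_zero
  have hxc : (x : ℤ) + 2 = c * w ^ 2 := by
    have : (w : ℤ) ^ 2 * c = x + 2 := by exact_mod_cast hcw
    linear_combination -this
  obtain ⟨S, hS⟩ : (w : ℤ) ∣ D * y := by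
    rw [← Int.pow_dvd_pow_iff two_ne_zero]
    exact ⟨c * D * (x - 2), by linear_combination -D * h + (x - 2) * D * hxc⟩
  have hS2 : S ^ 2 = c * D * (x - 2) := by
    have hw : ((w : ℤ) ^ 2) ≠ 0 := by exact_mod_cast pow_ne_zero 2 hw0
    apply mul_left_cancel₀ hw
    linear_combination -(w * S + D * y) * hS - D * h + (x - 2) * D * hxc
  have hdvd : ∀ {ℓ A : ℕ}, ℓ.Prime → Squarefree A → ℓ ∣ A → ∀ {B : ℤ}, S ^ 2 = A * B →
      (ℓ : ℤ) ∣ B := by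
    rintro ℓ A hℓ hA ⟨A', rfl⟩ B hAB
    have hℓ' : Prime (ℓ : ℤ) := Nat.prime_iff_prime_int.1 hℓ
    have hℓS : (ℓ : ℤ) ∣ S := hℓ'.dvd_of_dvd_pow ⟨A' * B, by rw [hAB]; push_cast; ring⟩
    obtain ⟨S', rfl⟩ := hℓS
    have h1 : (ℓ : ℤ) * S' ^ 2 = A' * B := by
      apply mul_left_cancel₀ hℓ'.ne_zero
      push_cast at hAB
      linear_combination hAB
    rcases hℓ'.dvd_or_dvd (⟨S' ^ 2, h1.symm⟩ : (ℓ : ℤ) ∣ A' * B) with h2 | h2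
    · exfalso
      obtain ⟨A'', rfl⟩ := Int.natCast_dvd_natCast.1 h2
      exact hℓ.one_lt.ne' (Nat.isUnit_iff.1 (hA ℓ ⟨A'', by ring⟩))
    · exact h2
  have h2q : c ∣ 2 * (p₁ * p₂) := by
    refine hc.dvd_of_forall_prime (by simp [hp₁.ne_zero, hp₂.ne_zero]) fun ℓ hℓ hℓc => ?_
    have hℓ' : Prime (ℓ : ℤ) := Nat.prime_iff_prime_int.1 hℓ
    have h1 : (ℓ : ℤ) ∣ D * (x - 2) := hdvd hℓ hc hℓc (by rw [hS2]; ring)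
    rcases hℓ'.dvd_or_dvd h1 with h1 | h1
    · have := Int.natCast_dvd_natCast.1 h1
      rcases hD with rfl | rfl
      · exact this.mul_left 2
      · exact this
    · have h3 : (ℓ : ℤ) ∣ x + 2 := by
        rw [hxc]; exact (Int.natCast_dvd_natCast.2 hℓc).mul_right _
      have h4 : (ℓ : ℤ) ∣ 2 ^ 2 := by
        have := dvd_sub h3 h1
        ring_nf at this ⊢; exact this
      have h5 : ℓ ∣ 2 := Int.natCast_dvd_natCast.1 (hℓ'.dvd_of_dvd_pow h4)
      exact h5.mul_right _
  have := Fact.mk hp₁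
  have hp₁2 : p₁ ≠ 2 := by rintro rfl; norm_num at hm₁
  have h20 : (2 : ZMod p₁) ≠ 0 := by
    intro h0
    have : p₁ ∣ 2 := (ZMod.natCast_eq_zero_iff 2 p₁).1 (by exact_mod_cast h0)
    exact hp₁2 ((Nat.prime_dvd_prime_iff_eq hp₁ Nat.prime_two).1 this)
  have hp₁D : p₁ ∣ D := by
    rcases hD with rfl | rfl
    · exact dvd_mul_right _ _
    · exact (dvd_mul_right _ _).mul_left _
  have hno2 : c ≠ 2 := by
    rintro rfl
    have h1 : (p₁ : ℤ) ∣ 2 * (x - 2) := hdvd hp₁ hsf hp₁D (by rw [hS2]; push_cast; ring)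
    have h2 := (ZMod.intCast_zmod_eq_zero_iff_dvd _ p₁).2 h1
    have h3 := congrArg (Int.cast (R := ZMod p₁)) hxc
    push_cast at h2 h3
    have : IsSquare (2 : ZMod p₁) := ⟨w, by
      have h4 : (2 : ZMod p₁) * (2 * 2) = 2 * (2 * (w * w)) := by
        linear_combination 2 * h3 - h2
      exact mul_left_cancel₀ h20 (mul_left_cancel₀ h20 h4)⟩
    rw [ZMod.exists_sq_eq_two_iff hp₁2] at this
    omega
  have hnoq : ((c * D : ℕ) : ℤ) ≠ 2 * (p₁ * p₂) ^ 2 ∨ ¬ p₁ ∣ c := by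
    by_contra! hcon
    obtain ⟨hcD, hpc⟩ := hcon
    push_cast at hcD
    rw [hcD] at hS2
    obtain ⟨T, rfl⟩ : ((p₁ : ℤ) * p₂) ∣ S := by
      rw [← Int.pow_dvd_pow_iff two_ne_zero]
      exact ⟨2 * (x - 2), by rw [hS2]; ring⟩
    have hq0 : ((p₁ : ℤ) * p₂) ≠ 0 := by exact_mod_cast mul_ne_zero hp₁.ne_zero hp₂.ne_zero
    have hT : T ^ 2 = 2 * (x - 2) := by
      apply mul_left_cancel₀ (pow_ne_zero 2 hq0)
      linear_combination hS2
    have h2 := congrArg (Int.cast (R := ZMod p₁)) hT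
    have h3 := congrArg (Int.cast (R := ZMod p₁)) hxc
    push_cast at h2 h3
    rw [(ZMod.natCast_eq_zero_iff c p₁).2 hpc] at h3
    have : IsSquare (-2 : ZMod p₁) := ⟨T / 2, by
      field_simp
      linear_combination -h2 - 2 * h3⟩
    rw [ZMod.exists_sq_eq_neg_two_iff hp₁2] at this
    omega
  refine ⟨c, w, hw0, by rw [← hcw]; ring, ?_⟩
  rcases dvd_two_mul_prime_mul_prime hp₁ hp₂ h2q with
    rfl | rfl | rfl | rfl | rfl | rfl | rfl | rfl
  · simp
  · exact absurd rfl hno2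
  · simp
  · simp
  · simp
  · simp
  · rcases hD with rfl | rfl
    · simp
    · rcases hnoq with h | h
      · exact absurd (by push_cast; ring) h
      · exact absurd (dvd_mul_right _ _) h
  · rcases hD with rfl | rfl
    · rcases hnoq with h | h
      · exact absurd (by push_cast; ring) h
      · exact absurd ((dvd_mul_right _ _).mul_left _) h
    · simp

/-- If the fundamental unit `ε` has norm one, then `p₁ ε` is a square in `ℚ(√2, √(p₁p₂))`. -/
theorem IsFundUnit.exists_sq_of_norm_one {p₁ p₂ D : ℕ} {ε : ℝ} (hp₁ : p₁.Prime) (hp₂ : p₂.Prime)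
    (hm₁ : p₁ % 8 = 5) (hsf : Squarefree D) (hD : D = p₁ * p₂ ∨ D = 2 * (p₁ * p₂))
    (hε : IsFundUnit D ε) {x y : ℤ} (hx : 0 < x) (hxy : ε = (x + y * √(D : ℝ)) / 2)
    (h : x ^ 2 - D * y ^ 2 = 4) : ∃ a ∈ biquad (p₁ * p₂), a ^ 2 = p₁ * ε := by
  lift x to ℕ using hx.le
  obtain ⟨c, w, hw0, hxc, hc⟩ := exists_mul_sq_of_norm_eq_four hp₁ hp₂ hm₁ hsf hD h
  have hw : (w : ℝ) ≠ 0 := by exact_mod_cast hw0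
  have hsq : √(D : ℝ) ^ 2 = D := Real.sq_sqrt (Nat.cast_nonneg D)
  have hDr : (D : ℝ) ≠ 0 := by exact_mod_cast hsf.ne_zero
  have hD1 : D ≠ 1 := by
    have h1 := hp₁.two_le
    have h2 := hp₂.two_le
    have : 2 * 2 ≤ p₁ * p₂ := Nat.mul_le_mul h1 h2
    omega
  have hR : (x : ℝ) ^ 2 - D * y ^ 2 = 4 := by exact_mod_cast h
  have hxcR : (x : ℝ) + 2 = c * w ^ 2 := by exact_mod_cast hxc
  have key : ((1 + ε) / w) ^ 2 = c * ε := by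
    have : (1 + ε) ^ 2 = ε * (x + 2) := by
      rw [hxy]
      push_cast
      linear_combination (y : ℝ) ^ 2 / 4 * hsq - hR / 4
    rw [div_pow, this, hxcR]; field_simp
  have hmem : (1 + ε) / w ∈ ℚ⟮√(D : ℝ)⟯ :=
    div_mem (add_mem (one_mem _) hε.mem) (_root_.natCast_mem _ w)
  have hmem' : (1 + ε) / w ∈ biquad (p₁ * p₂) := by
    rcases hD with rfl | rfl
    · exact biquad.adjoin_sqrt_le hmem
    · exact biquad.adjoin_sqrt_two_mul_le hmem
  have hq : √((p₁ * p₂ : ℕ) : ℝ) ^ 2 = p₁ * p₂ := by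
    rw [Real.sq_sqrt (Nat.cast_nonneg _)]; push_cast; rfl
  have hs2 : √(2 : ℝ) ^ 2 = 2 := Real.sq_sqrt zero_le_two
  have hp₂R : (p₂ : ℝ) ≠ 0 := by exact_mod_cast hp₂.ne_zero
  have mq : √((p₁ * p₂ : ℕ) : ℝ) ∈ biquad (p₁ * p₂) := biquad.sqrt_mem
  have m2 : √(2 : ℝ) ∈ biquad (p₁ * p₂) := biquad.sqrt_two_mem
  rcases hc with rfl | rfl | rfl | rfl | rfl | rfl
  · exact (hε.not_sq hsf hD1 hmem (by rw [key]; simp)).elim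
  · refine (hε.not_sq hsf hD1 (div_mem (mul_mem hmem (mem_adjoin_simple_self _ _))
      (_root_.natCast_mem _ c)) ?_).elim
    rw [div_pow, mul_pow, key, hsq]; field_simp
  · exact ⟨_, hmem', key⟩
  · refine ⟨_, div_mem hmem' m2, ?_⟩
    rw [div_pow, key, hs2]; push_cast; ring
  · refine ⟨_, div_mem (mul_mem hmem' mq) (_root_.natCast_mem _ c), ?_⟩
    rw [div_pow, mul_pow, key, hq]; field_simp
  · refine ⟨_, div_mem (mul_mem hmem' mq) (mul_mem m2 (_root_.natCast_mem _ p₂)), ?_⟩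
    rw [div_pow, mul_pow, key, hq, mul_pow, hs2]; push_cast; field_simp

namespace GaussianInt

theorem norm_eq_sq_add_sq (z : GaussianInt) : z.norm = z.re ^ 2 + z.im ^ 2 := by
  rw [Zsqrtd.norm_def]; ring

theorem prime_of_norm_eq_prime {z : GaussianInt} {p : ℕ} (hp : p.Prime) (hz : z.norm = p) :
    Prime z := by
  refine Irreducible.prime ⟨fun h => ?_, fun a b hab => ?_⟩
  · have := Zsqrtd.norm_eq_one_iff.2 h
    rw [hz, Int.natAbs_natCast] at this
    exact hp.one_lt.ne' this
  · have h : a.norm.natAbs * b.norm.natAbs = p := by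
      rw [← Int.natAbs_mul, ← Zsqrtd.norm_mul, ← hab, hz, Int.natAbs_natCast]
    rcases (Nat.dvd_prime hp).1 ⟨_, h.symm⟩ with h1 | h1
    · exact Or.inl (Zsqrtd.norm_eq_one_iff.1 h1)
    · refine Or.inr (Zsqrtd.norm_eq_one_iff.1 ?_)
      rw [h1] at h
      exact Nat.eq_of_mul_eq_mul_left hp.pos (by rw [h, mul_one])

theorem dvd_or_star_dvd {π z : GaussianInt} (hπ : Prime π) (h : π.norm ∣ z.norm) :
    π ∣ z ∨ star π ∣ z := by
  have h1 : π ∣ z * star z := by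
    rw [← Zsqrtd.norm_eq_mul_conj]
    refine Dvd.dvd.trans ⟨star π, Zsqrtd.norm_eq_mul_conj π⟩ ?_
    exact (Int.castRingHom GaussianInt).map_dvd h
  refine (hπ.dvd_or_dvd h1).imp id fun h2 => ?_
  obtain ⟨c, hc⟩ := h2
  exact ⟨star c, by rw [← star_mul', ← hc, star_star]⟩

theorem isCoprime_star {z r s : GaussianInt} (h : r * z + s * star z = 4) (hodd : Odd z.norm) :
    IsCoprime z (star z) := by
  obtain ⟨k, hk⟩ := hodd
  have hN : z * star z = 2 * k + 1 := by
    rw [← Zsqrtd.norm_eq_mul_conj, hk]; push_cast; rfl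
  have h4 : (z * star z) ^ 2 = 4 * (k ^ 2 + k) + 1 := by rw [hN]; ring
  exact ⟨z * star z ^ 2 - r * (k ^ 2 + k), -s * (k ^ 2 + k), by
    linear_combination h4 - ((k : GaussianInt) ^ 2 + k) * h⟩

/-- A Gaussian integer coprime to its conjugate whose norm is `p₁p₂` times a square is the product
of a prime above `p₁`, a prime above `p₂`, a square and a unit. -/
theorem exists_eq_mul_sq {π π' z : GaussianInt} {p₁ p₂ : ℕ} (hp₁ : p₁.Prime) (hp₂ : p₂.Prime)
    (hne : p₁ ≠ p₂) (hπ : π.norm = p₁) (hπ' : π'.norm = p₂) (hz : IsCoprime z (star z)) {m : ℤ}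
    (hnorm : z.norm = p₁ * p₂ * m ^ 2) :
    ∃ P P' u w : GaussianInt, (P = π ∨ P = star π) ∧ (P' = π' ∨ P' = star π') ∧ IsUnit u ∧
      z = u * P * P' * w ^ 2 := by
  obtain ⟨P, hP, hPn, hPz⟩ : ∃ P, (P = π ∨ P = star π) ∧ P.norm = p₁ ∧ P ∣ z := by
    rcases dvd_or_star_dvd (z := z) (prime_of_norm_eq_prime hp₁ hπ)
      (by rw [hπ, hnorm, mul_assoc]; exact dvd_mul_right _ _) with h | h
    · exact ⟨π, Or.inl rfl, hπ, h⟩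
    · exact ⟨star π, Or.inr rfl, by rw [Zsqrtd.norm_conj, hπ], h⟩
  obtain ⟨P', hP', hPn', hPz'⟩ : ∃ P', (P' = π' ∨ P' = star π') ∧ P'.norm = p₂ ∧ P' ∣ z := by
    rcases dvd_or_star_dvd (z := z) (prime_of_norm_eq_prime hp₂ hπ')
      (by rw [hπ', hnorm, mul_right_comm]; exact dvd_mul_left _ _) with h | h
    · exact ⟨π', Or.inl rfl, hπ', h⟩
    · exact ⟨star π', Or.inr rfl, by rw [Zsqrtd.norm_conj, hπ'], h⟩
  obtain ⟨z₁, rfl⟩ := hPz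
  have hP'pr := prime_of_norm_eq_prime hp₂ hPn'
  have hz₁ : P' ∣ z₁ := by
    refine (hP'pr.dvd_or_dvd hPz').resolve_left ?_
    rintro ⟨s, rfl⟩
    rw [Zsqrtd.norm_mul, hPn'] at hPn
    have : p₂ ∣ p₁ := Int.natCast_dvd_natCast.1 ⟨_, hPn.symm⟩
    exact hne ((Nat.prime_dvd_prime_iff_eq hp₂ hp₁).1 this).symm
  obtain ⟨z₂, rfl⟩ := hz₁
  have hn2 : z₂.norm = m ^ 2 := by
    rw [Zsqrtd.norm_mul, Zsqrtd.norm_mul, hPn, hPn'] at hnorm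
    have h1 : (p₁ : ℤ) ≠ 0 := by exact_mod_cast hp₁.ne_zero
    have h2 : (p₂ : ℤ) ≠ 0 := by exact_mod_cast hp₂.ne_zero
    apply mul_left_cancel₀ (mul_ne_zero h1 h2)
    linear_combination hnorm
  have hco : IsCoprime z₂ (star z₂) := by
    rw [star_mul', star_mul'] at hz
    exact hz.of_mul_left_right.of_mul_left_right.of_mul_right_right.of_mul_right_right
  obtain ⟨w, u, hw⟩ := exists_associated_pow_of_mul_eq_pow' hco (c := (m : GaussianInt)) (k := 2)
    (by rw [← Zsqrtd.norm_eq_mul_conj, hn2]; push_cast; rfl)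
  exact ⟨P, P', u, w, hP, hP', u.isUnit, by rw [← hw]; ring⟩

end GaussianInt

namespace biquadI

open Complex

variable {n : ℕ}

theorem toComplex_mem (z : GaussianInt) : GaussianInt.toComplex z ∈ biquadI n := by
  rw [GaussianInt.toComplex_def]
  exact add_mem (_root_.intCast_mem _ _) (mul_mem (_root_.intCast_mem _ _) I_mem)

theorem exists_sq_eq_unit {u : GaussianInt} (hu : IsUnit u) :
    ∃ κ ∈ biquadI n, κ ^ 2 = GaussianInt.toComplex u := by
  have hn := Zsqrtd.norm_eq_one_iff.2 hu
  have h : u.re ^ 2 + u.im ^ 2 = 1 := by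
    have := GaussianInt.norm_nonneg u
    rw [← GaussianInt.norm_eq_sq_add_sq]
    omega
  rw [GaussianInt.toComplex_def]
  have hz := zeta_sq
  have hI := I_sq
  have h1 : u.re ≤ 1 := by nlinarith
  have h2 : -1 ≤ u.re := by nlinarith
  have h3 : u.re = -1 ∨ u.re = 0 ∨ u.re = 1 := by omega
  rcases h3 with h3 | h3 | h3
  · have h4 : u.im = 0 := by rw [h3] at h; simpa using h
    exact ⟨I, I_mem, by rw [h3, h4, hI]; simp⟩
  · have h4 : u.im = 1 ∨ u.im = -1 := by rw [h3] at h; simpa using h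
    rcases h4 with h4 | h4
    · exact ⟨zeta, zeta_mem, by rw [h3, h4, hz]; simp⟩
    · exact ⟨I * zeta, mul_mem I_mem zeta_mem, by rw [h3, h4, mul_pow, hz, hI]; simp⟩
  · have h4 : u.im = 0 := by rw [h3] at h; simpa using h
    exact ⟨1, one_mem _, by rw [h3, h4]; simp⟩

theorem toComplex_mul_star {π : GaussianInt} {p : ℕ} (hπ : π.norm = p) :
    GaussianInt.toComplex π * GaussianInt.toComplex (star π) = p := by
  rw [← map_mul, ← Zsqrtd.norm_eq_mul_conj, hπ]; simp

theorem exists_sq_of_mul_eq_sq {π π' z : GaussianInt} {p₁ p₂ : ℕ} (hp₁ : p₁.Prime)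
    (hp₂ : p₂.Prime) (hne : p₁ ≠ p₂) (hπ : π.norm = p₁) (hπ' : π'.norm = p₂)
    (hz : IsCoprime z (star z)) {m : ℤ} (hm : m ≠ 0) (hnorm : z.norm = p₁ * p₂ * m ^ 2)
    {η A : ℂ} (hA : A ∈ biquadI (p₁ * p₂)) (hηA : η * GaussianInt.toComplex z = A ^ 2) :
    ∃ b ∈ biquadI (p₁ * p₂), η * GaussianInt.toComplex (π * π') = b ^ 2 ∨
      p₁ * (η * GaussianInt.toComplex (π * π')) = b ^ 2 := by
  have hz0 : GaussianInt.toComplex z ≠ 0 := by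
    rw [Ne, GaussianInt.toComplex_eq_zero]
    rintro rfl
    rw [Zsqrtd.norm_zero] at hnorm
    have h1 : (p₁ : ℤ) ≠ 0 := by exact_mod_cast hp₁.ne_zero
    have h2 : (p₂ : ℤ) ≠ 0 := by exact_mod_cast hp₂.ne_zero
    exact mul_ne_zero (mul_ne_zero h1 h2) (pow_ne_zero 2 hm) hnorm.symm
  suffices h : ∃ a ∈ biquadI (p₁ * p₂),
      GaussianInt.toComplex z * GaussianInt.toComplex (π * π') = a ^ 2 ∨
      p₁ * (GaussianInt.toComplex z * GaussianInt.toComplex (π * π')) = a ^ 2 by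
    obtain ⟨a, ha, h⟩ := h
    refine ⟨A * a / GaussianInt.toComplex z, div_mem (mul_mem hA ha) (toComplex_mem z),
      h.imp (fun h => ?_) fun h => ?_⟩ <;>
    · rw [div_pow, mul_pow, ← hηA, ← h]; field_simp
  obtain ⟨P, P', u, w, hP, hP', hu, rfl⟩ :=
    GaussianInt.exists_eq_mul_sq hp₁ hp₂ hne hπ hπ' hz hnorm
  obtain ⟨κ, hκ, hκu⟩ := exists_sq_eq_unit (n := p₁ * p₂) hu
  have hq : ((√((p₁ * p₂ : ℕ) : ℝ) : ℝ) : ℂ) ^ 2 = p₁ * p₂ := by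
    rw [← ofReal_pow, Real.sq_sqrt (Nat.cast_nonneg _)]; push_cast; rfl
  have mq : ((√((p₁ * p₂ : ℕ) : ℝ) : ℝ) : ℂ) ∈ biquadI (p₁ * p₂) := sqrt_mem
  have e1 := toComplex_mul_star hπ
  have e2 := toComplex_mul_star hπ'
  have mc := toComplex_mem (n := p₁ * p₂)
  simp only [map_mul, map_pow, ← hκu]
  set r := ((√((p₁ * p₂ : ℕ) : ℝ) : ℝ) : ℂ)
  set T := GaussianInt.toComplex
  rcases hP with rfl | rfl <;> rcases hP' with rfl | rfl
  · exact ⟨κ * T P * T P' * T w, mul_mem (mul_mem (mul_mem hκ (mc _)) (mc _)) (mc _),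
      Or.inl (by ring)⟩
  · refine ⟨κ * T P * r * T w, mul_mem (mul_mem (mul_mem hκ (mc _)) mq) (mc _), Or.inr ?_⟩
    linear_combination κ ^ 2 * T P ^ 2 * T w ^ 2 * (p₁ * e2 - hq)
  · refine ⟨κ * p₁ * T P' * T w,
      mul_mem (mul_mem (mul_mem hκ (_root_.natCast_mem _ _)) (mc _)) (mc _), Or.inr ?_⟩
    linear_combination κ ^ 2 * T P' ^ 2 * T w ^ 2 * p₁ * e1
  · refine ⟨κ * r * T w, mul_mem (mul_mem hκ mq) (mc _), Or.inl ?_⟩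
    linear_combination κ ^ 2 * T w ^ 2 * (T π' * T (star π') * e1 + p₁ * e2 - hq)

end biquadI

namespace IsFundUnit

open Complex

variable {n : ℕ} {ε : ℝ}

theorem exists_gaussianInt (h : IsFundUnit n ε) (hn4 : n % 4 = 1) {x y : ℤ} (hy : 0 < y)
    (hxy : ε = (x + y * √(n : ℝ)) / 2) (hnorm : x ^ 2 - n * y ^ 2 = -4) :
    ∃ z : GaussianInt, ∃ m : ℤ, m ≠ 0 ∧ IsCoprime z (star z) ∧ z.norm = n * m ^ 2 ∧
      ∃ A ∈ biquadI n, (ε : ℂ) * GaussianInt.toComplex z = A ^ 2 := by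
  have hsq : √(n : ℝ) ^ 2 = n := Real.sq_sqrt (Nat.cast_nonneg n)
  have hR : (x : ℝ) ^ 2 - n * y ^ 2 = -4 := by exact_mod_cast hnorm
  have hε : ε ^ 2 = x * ε + 1 := by
    rw [hxy]; linear_combination -hR / 4 + (y : ℝ) ^ 2 / 4 * hsq
  have hεC : (ε : ℂ) ^ 2 = x * ε + 1 := by exact_mod_cast hε
  have hεm : (ε : ℂ) ∈ biquadI n := biquadI.ofReal_mem (biquad.adjoin_sqrt_le h.mem)
  have hA : ((ε : ℂ) + I) ^ 2 = ε * (x + 2 * I) := by linear_combination hεC + I_sq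
  have hn4' : (n : ℤ) % 4 = 1 := by omega
  rcases Int.even_or_odd x with hx | hx
  · obtain ⟨x₁, rfl⟩ := hx
    have hy2 : Even y := by
      rw [← Int.not_odd_iff_even]
      intro hodd
      have h1 : Odd ((n : ℤ) * y ^ 2) := (Int.odd_iff.2 (by omega)).mul hodd.pow
      have h2 : (n : ℤ) * y ^ 2 = 2 * (2 * x₁ ^ 2 + 2) := by linear_combination -hnorm
      rw [h2] at h1
      exact Int.not_odd_iff_even.2 (even_two_mul _) h1
    obtain ⟨y₁, rfl⟩ := hy2
    have h3 : x₁ ^ 2 + 1 = n * y₁ ^ 2 := by linarith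
    have hodd : Odd ((n : ℤ) * y₁ ^ 2) := by
      refine (Int.odd_iff.2 (by omega)).mul (Odd.pow ?_)
      rw [← Int.not_even_iff_odd]
      rintro ⟨k, rfl⟩
      have h4 : x₁ ^ 2 + 1 = 4 * (n * k ^ 2) := by rw [h3]; ring
      rcases Int.even_or_odd x₁ with ⟨j, rfl⟩ | ⟨j, rfl⟩
      · ring_nf at h4; omega
      · ring_nf at h4; omega
    have hN : (⟨x₁, 1⟩ : GaussianInt).norm = n * y₁ ^ 2 := by
      rw [GaussianInt.norm_eq_sq_add_sq]; linear_combination h3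
    refine ⟨⟨x₁, 1⟩, y₁, by omega, ?_, hN, (ε + I) / ((√(2 : ℝ) : ℝ) : ℂ),
      div_mem (add_mem hεm biquadI.I_mem) biquadI.sqrt_two_mem, ?_⟩
    · apply GaussianInt.isCoprime_star (r := ⟨0, -2⟩) (s := ⟨0, 2⟩)
      · ext <;> simp
      · rwa [hN]
    · have h2 : ((√(2 : ℝ) : ℝ) : ℂ) ^ 2 = 2 := by
        rw [← ofReal_pow, Real.sq_sqrt zero_le_two]; norm_num
      rw [div_pow, h2, hA, GaussianInt.toComplex_def]
      push_cast; ring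
  · have hN : (⟨x, 2⟩ : GaussianInt).norm = n * y ^ 2 := by
      rw [GaussianInt.norm_eq_sq_add_sq]; linear_combination hnorm
    refine ⟨⟨x, 2⟩, y, hy.ne', ?_, hN, ε + I, add_mem hεm biquadI.I_mem, ?_⟩
    · apply GaussianInt.isCoprime_star (r := ⟨0, -1⟩) (s := ⟨0, 1⟩)
      · ext <;> simp
      · rw [GaussianInt.norm_eq_sq_add_sq]
        exact hx.pow.add_even ⟨2, rfl⟩
    · rw [hA, GaussianInt.toComplex_def]
      push_cast; ring

theorem exists_gaussianInt_two_mul {ε₂ : ℝ} (h₂ : IsFundUnit 2 ε₂) (h : IsFundUnit (2 * n) ε)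
    (hn : Odd n) {x y : ℤ} (hy : 0 < y)
    (hxy : ε = (x + y * √((2 * n : ℕ) : ℝ)) / 2) (hnorm : x ^ 2 - (2 * n : ℕ) * y ^ 2 = -4) :
    ∃ z : GaussianInt, ∃ m : ℤ, m ≠ 0 ∧ IsCoprime z (star z) ∧ z.norm = n * m ^ 2 ∧
      ∃ A ∈ biquadI n, (ε₂ * ε : ℂ) * GaussianInt.toComplex z = A ^ 2 := by
  have hsq : √((2 * n : ℕ) : ℝ) ^ 2 = (2 * n : ℕ) := Real.sq_sqrt (Nat.cast_nonneg _)
  have hR : (x : ℝ) ^ 2 - (2 * n : ℕ) * y ^ 2 = -4 := by exact_mod_cast hnorm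
  have hε : ε ^ 2 = x * ε + 1 := by
    rw [hxy]; linear_combination -hR / 4 + (y : ℝ) ^ 2 / 4 * hsq
  have hεC : (ε : ℂ) ^ 2 = x * ε + 1 := by exact_mod_cast hε
  have hεm : (ε : ℂ) ∈ biquadI n := biquadI.ofReal_mem (biquad.adjoin_sqrt_two_mul_le h.mem)
  have hε₂m : (ε₂ : ℂ) ∈ biquadI n :=
    biquadI.ofReal_mem (biquad.adjoin_sqrt_two_le (by exact_mod_cast h₂.mem))
  have h2 : ((√(2 : ℝ) : ℝ) : ℂ) ^ 2 = 2 := by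
    rw [← ofReal_pow, Real.sq_sqrt zero_le_two]; norm_num
  have hA₂ : ((ε₂ : ℂ) + I) ^ 2 = ε₂ * (2 + 2 * I) := by
    rw [h₂.eq_one_add_sqrt_two]; push_cast; linear_combination h2 + I_sq
  have hA : ((ε : ℂ) + I) ^ 2 = ε * (x + 2 * I) := by linear_combination hεC + I_sq
  push_cast at hnorm
  have hn2 : (n : ℤ) % 2 = 1 := by have := Nat.odd_iff.1 hn; omega
  have hx : Even x := by
    rw [← Int.not_odd_iff_even]
    intro hodd
    have h1 : x ^ 2 = 2 * (n * y ^ 2 - 2) := by linear_combination hnorm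
    have h3 := hodd.pow (n := 2)
    rw [h1] at h3
    exact Int.not_odd_iff_even.2 (even_two_mul _) h3
  obtain ⟨c, rfl⟩ := hx
  have hy2 : Even y := by
    rw [← Int.not_odd_iff_even]
    intro hodd
    have h1 : Odd ((n : ℤ) * y ^ 2) := (Int.odd_iff.2 (by omega)).mul hodd.pow
    have h2 : (n : ℤ) * y ^ 2 = 2 * (c ^ 2 + 1) := by linarith
    rw [h2] at h1
    exact Int.not_odd_iff_even.2 (even_two_mul _) h1
  obtain ⟨y₁, rfl⟩ := hy2
  have h3 : c ^ 2 + 1 = 2 * (n * y₁ ^ 2) := by linarith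
  have hc : Odd c := by
    rw [← Int.not_even_iff_odd]
    rintro ⟨k, rfl⟩
    ring_nf at h3; omega
  obtain ⟨k, rfl⟩ := hc
  have hN : (⟨k + 1, -k⟩ : GaussianInt).norm = n * y₁ ^ 2 := by
    rw [GaussianInt.norm_eq_sq_add_sq]; linarith
  refine ⟨⟨k + 1, -k⟩, y₁, by omega, ?_, hN,
    (ε₂ + I) * (ε + I) / (2 * ((√(2 : ℝ) : ℝ) : ℂ) * biquadI.zeta),
    div_mem (mul_mem (add_mem hε₂m biquadI.I_mem) (add_mem hεm biquadI.I_mem))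
      (mul_mem (mul_mem (ofNat_mem _ 2) biquadI.sqrt_two_mem) biquadI.zeta_mem), ?_⟩
  · apply GaussianInt.isCoprime_star (r := ⟨2, -2⟩) (s := ⟨2, 2⟩)
    · ext <;> simp <;> ring
    · rw [GaussianInt.norm_eq_sq_add_sq]
      exact ⟨k ^ 2 + k, by ring⟩
  · rw [div_pow, mul_pow, mul_pow, mul_pow, h2, hA₂, hA, biquadI.zeta_sq,
      eq_div_iff (by simp), GaussianInt.toComplex_def]
    push_cast
    linear_combination (-8 * (k : ℂ) - 4) * ε₂ * ε * I_sq

end IsFundUnit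

namespace biquadI

open Complex

theorem exists_sq_of_ofReal_eq_sq {n : ℕ} {r : ℝ} (hr : 0 < r) {a : ℂ} (ha : a ∈ biquadI n)
    (h : (r : ℂ) = a ^ 2) : ∃ t ∈ biquad n, t ^ 2 = r := by
  refine ⟨√r, mem_biquad_of_ofReal_mem ?_, Real.sq_sqrt hr.le⟩
  have : ((√r : ℝ) : ℂ) ^ 2 = a ^ 2 := by rw [← ofReal_pow, Real.sq_sqrt hr.le, h]
  rcases sq_eq_sq_iff_eq_or_eq_neg.1 this with h | h <;> rw [h]
  · exact ha
  · exact neg_mem ha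

/-- If the product of the three fundamental units is not a square in `ℚ(√2, √(p₁p₂))`, then `p₁`
is associated to a square in `ℚ(√2, √(p₁p₂), i)`. -/
theorem exists_sq_div_unit {p₁ p₂ : ℕ} (hp₁ : p₁.Prime) (hp₂ : p₂.Prime) (hne : p₁ ≠ p₂)
    (hm₁ : p₁ % 8 = 5) (hm₂ : p₂ % 8 = 5) (hsf : Squarefree (p₁ * p₂))
    (hsf2 : Squarefree (2 * (p₁ * p₂))) {π π' : GaussianInt} (hπ : π.norm = p₁)
    (hπ' : π'.norm = p₂) {ε₂ ε₁ ε₃ : ℝ} (h₂ : IsFundUnit 2 ε₂) (h₁ : IsFundUnit (p₁ * p₂) ε₁)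
    (h₃ : IsFundUnit (2 * (p₁ * p₂)) ε₃)
    (hns : ¬ ∃ t ∈ biquad (p₁ * p₂), t ^ 2 = ε₂ * ε₁ * ε₃) :
    ∃ α ∈ biquadI (p₁ * p₂), IsIntUnit (α ^ 2 / (p₁ : ℂ)) := by
  have hp0 : (p₁ : ℂ) ≠ 0 := by exact_mod_cast hp₁.ne_zero
  have real : ∀ {ε : ℝ}, IsIntUnit ε → (∃ a ∈ biquad (p₁ * p₂), a ^ 2 = p₁ * ε) →
      ∃ α ∈ biquadI (p₁ * p₂), IsIntUnit (α ^ 2 / (p₁ : ℂ)) := by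
    rintro ε hε ⟨a, ha, h⟩
    refine ⟨a, ofReal_mem ha, ?_⟩
    rw [← ofReal_pow, h]
    push_cast
    rw [mul_div_cancel_left₀ _ hp0]
    exact hε.map ofRealHom
  obtain ⟨x, y, hx, hy, hxy, hnorm⟩ := h₁.exists_int
  obtain ⟨X, Y, hX, hY, hXY, hNorm⟩ := h₃.exists_int
  rcases hnorm with hnorm | hnorm
  · exact real h₁.isIntUnit
      (h₁.exists_sq_of_norm_one hp₁ hp₂ hm₁ hsf (Or.inl rfl) hx hxy hnorm)
  rcases hNorm with hNorm | hNorm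
  · exact real h₃.isIntUnit
      (h₃.exists_sq_of_norm_one hp₁ hp₂ hm₁ hsf2 (Or.inr rfl) hX hXY hNorm)
  have hmod : (p₁ * p₂) % 4 = 1 := by
    rw [Nat.mul_mod, show p₁ % 4 = 1 by omega, show p₂ % 4 = 1 by omega]
  obtain ⟨z, m, hm, hz, hzn, A, hA, hzA⟩ := h₁.exists_gaussianInt hmod hy hxy hnorm
  obtain ⟨Z, M, hM, hZ, hZn, B, hB, hZB⟩ :=
    h₂.exists_gaussianInt_two_mul h₃ (Nat.odd_iff.2 (by omega)) hY hXY hNorm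
  obtain ⟨b, hb, hb'⟩ := exists_sq_of_mul_eq_sq hp₁ hp₂ hne hπ hπ' hz hm
    (by rw [hzn]; push_cast; ring) hA hzA
  obtain ⟨c, hc, hc'⟩ := exists_sq_of_mul_eq_sq hp₁ hp₂ hne hπ hπ' hZ hM
    (by rw [hZn]; push_cast; ring) hB hZB
  set G := GaussianInt.toComplex (π * π') with hG
  have hG0 : G ≠ 0 := by
    have h1 := toComplex_mul_star hπ
    have h2 := toComplex_mul_star hπ'
    rw [hG, map_mul]
    have hp0' : (p₂ : ℂ) ≠ 0 := by exact_mod_cast hp₂.ne_zero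
    exact mul_ne_zero (left_ne_zero_of_mul (h1 ▸ hp0)) (left_ne_zero_of_mul (h2 ▸ hp0'))
  have hGm : G ∈ biquadI (p₁ * p₂) := toComplex_mem _
  have hpm : (p₁ : ℂ) ∈ biquadI (p₁ * p₂) := _root_.natCast_mem _ p₁
  have hpos : 0 < ε₂ * ε₁ * ε₃ := mul_pos (mul_pos h₂.pos h₁.pos) h₃.pos
  have square : ∀ {a : ℂ}, a ∈ biquadI (p₁ * p₂) → (ε₁ * G * (ε₂ * ε₃ * G) : ℂ) = a ^ 2 →
      ∃ α ∈ biquadI (p₁ * p₂), IsIntUnit (α ^ 2 / (p₁ : ℂ)) := by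
    intro a ha h
    refine (hns (exists_sq_of_ofReal_eq_sq hpos (div_mem ha hGm) ?_)).elim
    rw [div_pow, ← h]; push_cast; field_simp
  have square' : ∀ {a : ℂ}, a ∈ biquadI (p₁ * p₂) →
      (p₁ * (ε₁ * G * (ε₂ * ε₃ * G)) : ℂ) = a ^ 2 →
      ∃ α ∈ biquadI (p₁ * p₂), IsIntUnit (α ^ 2 / (p₁ : ℂ)) := by
    intro a ha h
    refine ⟨a / G, div_mem ha hGm, ?_⟩
    have e : (a / G) ^ 2 / p₁ = ofRealHom (ε₂ * ε₁ * ε₃) := by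
      rw [div_pow, ← h]; simp; field_simp
    rw [e]
    exact ((h₂.isIntUnit.mul h₁.isIntUnit).mul h₃.isIntUnit).map ofRealHom
  rcases hb' with hb' | hb' <;> rcases hc' with hc' | hc'
  · exact square (mul_mem hb hc) (by rw [hb', hc', mul_pow])
  · exact square' (mul_mem hb hc) (by rw [hb', mul_pow, ← hc']; ring)
  · exact square' (mul_mem hb hc) (by rw [hc', mul_pow, ← hb']; ring)
  · exact square (div_mem (mul_mem hb hc) hpm) (by
      rw [div_pow, mul_pow, ← hb', ← hc']; field_simp)

end biquadI

theorem Ideal.span_pair_sq_of_isCoprime {R : Type*} [CommRing R] {x ω t : R} (h : ω ^ 2 = x * t)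
    (hco : IsCoprime x t) : Ideal.span {x, ω} ^ 2 = Ideal.span {x} := by
  rw [sq, Ideal.span_pair_mul_span_pair]
  apply le_antisymm
  · rw [Ideal.span_le]
    rintro z (rfl | rfl | rfl | rfl) <;>
      rw [SetLike.mem_coe, Ideal.mem_span_singleton]
    · exact dvd_mul_right _ _
    · exact dvd_mul_right _ _
    · exact dvd_mul_left _ _
    · exact ⟨t, by rw [← h, sq]⟩
  · rw [Ideal.span_singleton_le_iff_mem]
    obtain ⟨a, b, hab⟩ := hco
    have e : a * (x * x) + b * (ω * ω) = x := by linear_combination x * hab + b * h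
    have hmem : a * (x * x) + b * (ω * ω) ∈ Ideal.span {x * x, x * ω, ω * x, ω * ω} :=
      add_mem (Ideal.mul_mem_left _ _ (Ideal.subset_span (by simp)))
        (Ideal.mul_mem_left _ _ (Ideal.subset_span (by simp)))
    rwa [e] at hmem

theorem Nat.Prime.eq_and_eq_of_mul_sq_eq_pow {p N₁ N₂ m : ℕ} (hp : p.Prime) (hm : m ≤ 4)
    (h₁ : N₁ ≠ 1) (h₂ : N₂ ≠ 1) (h : (N₁ * N₂) ^ 2 = p ^ m) : N₁ = p ∧ N₂ = p := by
  obtain ⟨k₁, -, rfl⟩ := (Nat.dvd_prime_pow hp).1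
    (h ▸ (dvd_mul_right N₁ N₂).trans (dvd_pow_self _ two_ne_zero))
  obtain ⟨k₂, -, rfl⟩ := (Nat.dvd_prime_pow hp).1
    (h ▸ (dvd_mul_left N₂ (p ^ k₁)).trans (dvd_pow_self _ two_ne_zero))
  rw [← pow_add, ← pow_mul] at h
  have := Nat.pow_right_injective hp.two_le h
  have h1 : k₁ ≠ 0 := by rintro rfl; simp at h₁
  have h2 : k₂ ≠ 0 := by rintro rfl; simp at h₂
  obtain rfl : k₁ = 1 := by omega
  obtain rfl : k₂ = 1 := by omega
  simp

namespace NumberField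

/-- Two ramified primes of a number field of degree at most four. -/
theorem sq_mul_eq_span_of_ramified {K : Type*} [Field K] [NumberField K]
    (hK : Module.finrank ℚ K ≤ 4) {p : ℕ} (hp : p.Prime) {x y ω s t : 𝓞 K} (hxy : x * y = p)
    (hx : ω ^ 2 = x * t) (hy : ω ^ 2 = y * s) (hxt : IsCoprime x t) (hys : IsCoprime y s)
    {H₁ H₂ : Ideal (𝓞 K)} (h₁ : H₁.IsPrime) (h₂ : H₂.IsPrime) (hx₁ : x ∈ H₁) (hy₂ : y ∈ H₂) :
    (H₁ * H₂) ^ 2 = Ideal.span {(p : 𝓞 K)} := by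
  have le₁ : Ideal.span {x, ω} ≤ H₁ := by
    rw [Ideal.span_le]
    rintro z (rfl | rfl)
    · exact hx₁
    · exact h₁.mem_of_pow_mem 2 (by rw [hx]; exact Ideal.mul_mem_right _ _ hx₁)
  have le₂ : Ideal.span {y, ω} ≤ H₂ := by
    rw [Ideal.span_le]
    rintro z (rfl | rfl)
    · exact hy₂
    · exact h₂.mem_of_pow_mem 2 (by rw [hy]; exact Ideal.mul_mem_right _ _ hy₂)
  have e : (Ideal.span {x, ω} * Ideal.span {y, ω}) ^ 2 = Ideal.span {(p : 𝓞 K)} := by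
    rw [mul_pow, Ideal.span_pair_sq_of_isCoprime hx hxt, Ideal.span_pair_sq_of_isCoprime hy hys,
      Ideal.span_singleton_mul_span_singleton, hxy]
  have hN := congrArg Ideal.absNorm e
  have hpn : (p : 𝓞 K) = algebraMap ℤ (𝓞 K) (p : ℤ) := by simp
  rw [map_pow, map_mul, Ideal.absNorm_span_singleton, hpn, Algebra.norm_algebraMap,
    Int.natAbs_pow, Int.natAbs_natCast, RingOfIntegers.rank] at hN
  obtain ⟨n₁, n₂⟩ := hp.eq_and_eq_of_mul_sq_eq_pow hK
    (fun h => h₁.ne_top (top_le_iff.1 ((Ideal.absNorm_eq_one_iff.1 h).symm.trans_le le₁)))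
    (fun h => h₂.ne_top (top_le_iff.1 ((Ideal.absNorm_eq_one_iff.1 h).symm.trans_le le₂))) hN
  have max : ∀ {J H : Ideal (𝓞 K)}, Ideal.absNorm J = p → H.IsPrime → J ≤ H → J = H := by
    intro J H hJ hH hJH
    have hJp : J.IsPrime := Ideal.isPrime_of_irreducible_absNorm (by rw [hJ]; exact hp)
    have hJ0 : J ≠ ⊥ := by
      rintro rfl
      rw [Ideal.absNorm_bot] at hJ
      exact hp.ne_zero hJ.symm
    exact (hJp.isMaximal hJ0).eq_of_le hH.ne_top hJH
  rw [← max n₁ h₁ le₁, ← max n₂ h₂ le₂, e]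

theorem isPrincipal_iff_of_sq_eq_span {K : IntermediateField ℚ ℂ} [NumberField K] {p : ℕ}
    (hp : p ≠ 0) {I : Ideal (𝓞 K)} (hI : I ^ 2 = Ideal.span {(p : 𝓞 K)}) :
    I.IsPrincipal ↔ ∃ α ∈ K, IsIntUnit (α ^ 2 / (p : ℂ)) := by
  have hp0 : (p : ℂ) ≠ 0 := by exact_mod_cast hp
  let ι : 𝓞 K →+* ℂ := (algebraMap K ℂ).comp (algebraMap (𝓞 K) K)
  have hι : Function.Injective ι :=
    (algebraMap K ℂ).injective.comp (FaithfulSMul.algebraMap_injective (𝓞 K) K)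
  have int : ∀ a : 𝓞 K, IsIntegral ℤ (ι a) := fun a =>
    (RingOfIntegers.isIntegral_coe a).map (algebraMap K ℂ).toIntAlgHom
  have lift : ∀ z ∈ K, IsIntegral ℤ z → ∃ a : 𝓞 K, ι a = z := fun z hz hint =>
    ⟨⟨⟨z, hz⟩, (isIntegral_algHom_iff (algebraMap K ℂ).toIntAlgHom
      (algebraMap K ℂ).injective).1 hint⟩, rfl⟩
  constructor
  · rintro ⟨a, ha⟩
    rw [Ideal.submodule_span_eq] at ha
    rw [ha, sq, Ideal.span_singleton_mul_span_singleton,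
      Ideal.span_singleton_eq_span_singleton] at hI
    obtain ⟨u, hu⟩ := hI.symm
    refine ⟨ι a, (algebraMap (𝓞 K) K a).2, ?_⟩
    have h1 : ι a ^ 2 / p = ι u := by
      rw [div_eq_iff hp0, sq, ← map_mul, ← hu, map_mul, map_natCast, mul_comm]
    have h2 : ι u * ι (u⁻¹ : (𝓞 K)ˣ) = 1 := by rw [← map_mul, Units.mul_inv, map_one]
    rw [h1]
    refine ⟨left_ne_zero_of_mul_eq_one h2, int _, ?_⟩
    rw [inv_eq_of_mul_eq_one_right h2]
    exact int _
  · rintro ⟨α, hα, h0, h1, h2⟩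
    have hαint : IsIntegral ℤ α := by
      have hpi : IsIntegral ℤ (p : ℂ) := map_natCast (algebraMap ℤ ℂ) p ▸ isIntegral_algebraMap
      refine IsIntegral.of_pow two_pos ?_
      rw [← div_mul_cancel₀ (α ^ 2) hp0]
      exact h1.mul hpi
    obtain ⟨a, ha⟩ := lift α hα hαint
    have hm : α ^ 2 / p ∈ K := div_mem (_root_.pow_mem hα 2) (_root_.natCast_mem _ p)
    obtain ⟨u, hu⟩ := lift _ hm h1
    obtain ⟨v, hv⟩ := lift _ (inv_mem hm) h2
    have huv : u * v = 1 := hι (by rw [map_mul, hu, hv, map_one, mul_inv_cancel₀ h0])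
    have hau : (p : 𝓞 K) * u = a * a := hι (by
      rw [map_mul, map_mul, ha, hu, map_natCast]; field_simp)
    have : I = Ideal.span {a} := by
      refine pow_left_injective two_ne_zero ?_
      change I ^ 2 = Ideal.span {a} ^ 2
      rw [hI, sq, Ideal.span_singleton_mul_span_singleton,
        Ideal.span_singleton_eq_span_singleton]
      exact ⟨⟨u, v, huv, by rw [mul_comm, huv]⟩, hau⟩
    exact ⟨a, this⟩

end NumberField

theorem finrank_adjoin_pair_le_four_s13 {F E : Type*} [Field F] [Field E] [Algebra F E] {r s : E}
    {a b : F} (hr : r ^ 2 = algebraMap F E a) (hs : s ^ 2 = algebraMap F E b) :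
    Module.finrank F F⟮r, s⟯ ≤ 4 := by
  have key : ∀ {x : E} {c : F}, x ^ 2 = algebraMap F E c → Module.finrank F F⟮x⟯ ≤ 2 := by
    intro x c hx
    have h0 : (Polynomial.X ^ 2 - Polynomial.C c : Polynomial F) ≠ 0 :=
      (Polynomial.monic_X_pow_sub_C c two_ne_zero).ne_zero
    have hroot : Polynomial.aeval x (Polynomial.X ^ 2 - Polynomial.C c : Polynomial F) = 0 := by
      simp [hx]
    have hint : IsIntegral F x := ⟨_, Polynomial.monic_X_pow_sub_C c two_ne_zero, hroot⟩
    rw [adjoin.finrank hint]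
    refine (Polynomial.natDegree_le_of_dvd (minpoly.dvd F x hroot) h0).trans_eq ?_
    exact Polynomial.natDegree_X_pow_sub_C
  have h : F⟮r, s⟯ = F⟮r⟯ ⊔ F⟮s⟯ := by rw [← adjoin_union]; rfl
  rw [h]
  exact (finrank_sup_le _ _).trans (Nat.mul_le_mul (key hr) (key hs))

theorem biquad.sq_ne_natCast_of_mul {p q : ℕ} (hp : p.Prime) (hq : q.Prime)
    (hsf : Squarefree (p * q)) (hsf2 : Squarefree (2 * (p * q))) :
    ∀ x ∈ biquad (p * q), x ^ 2 ≠ p := by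
  have irr : ∀ {D : ℕ}, Squarefree D → D ≠ 1 → ∀ A : ℚ, A ^ 2 ≠ D := by
    intro D hD h1 A hA
    refine irrational_sqrt_of_squarefree hD h1 ⟨|A|, ?_⟩
    rw [Rat.cast_abs, ← Real.sqrt_sq_eq_abs, ← Rat.cast_pow, hA, Rat.cast_natCast]
  have hp0 : (p : ℚ) ≠ 0 := by exact_mod_cast hp.ne_zero
  have s2p : Squarefree (2 * p) := hsf2.squarefree_of_dvd ⟨q, by ring⟩
  have s2q : Squarefree (2 * q) := hsf2.squarefree_of_dvd ⟨p, by ring⟩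
  have hpq1 : p * q ≠ 1 := fun hn => hp.one_lt.ne' (Nat.eq_one_of_mul_eq_one_right hn)
  intro x hx hxp
  obtain ⟨A, hA | hA | hA | hA⟩ := biquad.sq_eq_natCast
    (by exact_mod_cast irrational_sqrt_of_squarefree Nat.prime_two.prime.squarefree (by norm_num))
    (irrational_sqrt_of_squarefree hsf hpq1)
    (irrational_sqrt_of_squarefree hsf2 (by omega)) hx hxp
  · exact irr hp.prime.squarefree hp.ne_one A hA
  · exact irr s2p (by omega) (2 * A) (by push_cast; linear_combination 2 * hA)
  · refine irr hq.prime.squarefree hq.ne_one (q * A) (mul_left_cancel₀ hp0 ?_)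
    push_cast at hA
    linear_combination (q : ℚ) * hA
  · refine irr s2q (by omega) (2 * q * A) (mul_left_cancel₀ hp0 ?_)
    push_cast at hA ⊢
    linear_combination 2 * (q : ℚ) * hA

namespace NumberField

/-- In `ℚ(√(2pq), i)` the two primes above the Gaussian prime factors of `p` multiply to an
ideal with square `(p)`. -/
theorem sq_mul_eq_span_of_primes_above {p q : ℕ} (hp : p.Prime) (hq : q.Prime) (hne : p ≠ q)
    (hodd : p % 2 = 1) {e f : ℤ} (hef : (p : ℤ) = e ^ 2 + 4 * f ^ 2) {K : IntermediateField ℚ ℂ}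
    (hK : K = ℚ⟮((√(2 * (p : ℝ) * q) : ℝ) : ℂ), Complex.I⟯) [NumberField K]
    {H₁ H₂ : Ideal (𝓞 K)} (h₁ : H₁.IsPrime) (h₂ : H₂.IsPrime)
    (hH₁ : ∀ u : 𝓞 K, ((algebraMap (𝓞 K) K u : K) : ℂ) = (e : ℂ) + 2 * f * Complex.I → u ∈ H₁)
    (hH₂ : ∀ u : 𝓞 K, ((algebraMap (𝓞 K) K u : K) : ℂ) = (e : ℂ) - 2 * f * Complex.I → u ∈ H₂) :
    (H₁ * H₂) ^ 2 = Ideal.span {(p : 𝓞 K)} := by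
  have hr : ((√(2 * (p : ℝ) * q) : ℝ) : ℂ) ^ 2 = 2 * p * q := by
    rw [← Complex.ofReal_pow, Real.sq_sqrt (by positivity)]
    push_cast
    rfl
  let ι : 𝓞 K →+* ℂ := (algebraMap K ℂ).comp (algebraMap (𝓞 K) K)
  have hιe : ∀ u : 𝓞 K, ((algebraMap (𝓞 K) K u : K) : ℂ) = ι u := fun _ => rfl
  have hι : Function.Injective ι :=
    (algebraMap K ℂ).injective.comp (FaithfulSMul.algebraMap_injective (𝓞 K) K)
  have lift : ∀ z ∈ K, IsIntegral ℤ z → ∃ a : 𝓞 K, ι a = z := fun z hz hint =>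
    ⟨⟨⟨z, hz⟩, (isIntegral_algHom_iff (algebraMap K ℂ).toIntAlgHom
      (algebraMap K ℂ).injective).1 hint⟩, rfl⟩
  obtain ⟨j, hj⟩ : ∃ j : 𝓞 K, ι j = Complex.I := by
    refine lift _ (hK ▸ subset_adjoin _ _ (by simp)) (IsIntegral.of_pow two_pos ?_)
    rw [Complex.I_sq]
    exact isIntegral_one.neg
  obtain ⟨ω, hω⟩ : ∃ ω : 𝓞 K, ι ω = ((√(2 * (p : ℝ) * q) : ℝ) : ℂ) := by
    refine lift _ (hK ▸ subset_adjoin _ _ (by simp)) (IsIntegral.of_pow two_pos ?_)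
    rw [hr]
    exact_mod_cast isIntegral_algebraMap (R := ℤ) (A := ℂ) (x := (2 * p * q : ℕ))
  have hj2 : j ^ 2 = -1 := hι (by rw [map_pow, hj, Complex.I_sq, map_neg, map_one])
  have hω2 : ω ^ 2 = 2 * p * q := hι (by
    rw [map_pow, hω, hr, map_mul, map_mul, map_natCast, map_natCast, map_ofNat])
  have hef' : (p : 𝓞 K) = e ^ 2 + 4 * f ^ 2 := by exact_mod_cast congrArg (Int.cast : ℤ → 𝓞 K) hef
  have hxy : ((e : 𝓞 K) + 2 * f * j) * (e - 2 * f * j) = p := by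
    rw [hef']; linear_combination -4 * (f : 𝓞 K) ^ 2 * hj2
  have cast : ∀ {a b : ℤ}, IsCoprime a b → IsCoprime (a : 𝓞 K) (b : 𝓞 K) := fun hab => by
    simpa using hab.map (Int.castRingHom (𝓞 K))
  have copq : IsCoprime (p : 𝓞 K) (q : 𝓞 K) := by
    simpa using cast (Nat.isCoprime_iff_coprime.2 ((Nat.coprime_primes hp hq).2 hne))
  have cop2 : IsCoprime (p : 𝓞 K) 2 := by
    simpa using cast (Nat.isCoprime_iff_coprime.2
      (Nat.coprime_two_right.2 (Nat.odd_iff.2 hodd)))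
  have cope : IsCoprime (p : 𝓞 K) (e : 𝓞 K) := by
    have hpe : IsCoprime (p : ℤ) e := by
      rw [(Nat.prime_iff_prime_int.1 hp).coprime_iff_not_dvd]
      rintro ⟨k, rfl⟩
      have hp1 : (1 : ℤ) < p := by exact_mod_cast hp.one_lt
      rcases eq_or_ne k 0 with rfl | hk
      · have : (p : ℤ) = 4 * f ^ 2 := by linarith
        omega
      · have : 0 < k ^ 2 := by positivity
        nlinarith [sq_nonneg f, mul_le_mul_of_nonneg_left (Int.add_one_le_iff.2 this)
          (sq_nonneg (p : ℤ))]
    simpa using cast hpe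
  have cop : ∀ {x y : 𝓞 K}, x * y = p → x + y = 2 * e → IsCoprime x (2 * y * q) := by
    intro x y hxy hadd
    have hxp : ∀ {z : 𝓞 K}, IsCoprime (p : 𝓞 K) z → IsCoprime x z := fun hz =>
      IsCoprime.of_mul_left_left (hxy ▸ hz)
    refine ((hxp cop2).mul_right ?_).mul_right (hxp copq)
    have := hxp (cop2.mul_right cope)
    rw [← hadd] at this
    simpa using this.add_mul_left_right (-1)
  refine sq_mul_eq_span_of_ramified ?_ hp hxy (ω := ω) (t := 2 * (e - 2 * f * j) * q)
    (s := 2 * (e + 2 * f * j) * q) ?_ ?_ (cop hxy (by ring))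
    (cop (by rw [mul_comm, hxy]) (by ring)) h₁ h₂ (hH₁ _ ?_) (hH₂ _ ?_)
  · have h4 := finrank_adjoin_pair_le_four_s13 (F := ℚ) (a := 2 * p * q) (b := -1) (s := Complex.I)
      (by rw [hr]; simp) (by simp)
    rw [← hK] at h4
    convert h4
  · rw [hω2, ← hxy]; ring
  · rw [hω2, ← hxy]; ring
  · rw [hιe]
    simp [hj, map_ofNat ι 2]
  · rw [hιe]
    simp [hj, map_ofNat ι 2]

end NumberField

/-- Let `H₁`, `H₂` be the primes of `𝓞_𝕜` (`𝕜 = ℚ(√(2p₁p₂), i)`) above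
the Gaussian primes `π₁ = e + 2if` and `π₂ = e - 2if`.  The ideal `(H₁H₂)·𝓞_{K₃}` of
`K₃ = ℚ(√2, √(p₁p₂), i)` is principal if and only if `ε₂·ε_{p₁p₂}·ε_{2p₁p₂}` is not a
square in `K₃⁺ = ℚ(√2, √(p₁p₂))`. -/
theorem stmt_13 (p₁ p₂ : ℕ) (hp₁ : p₁.Prime) (hp₂ : p₂.Prime) (hne : p₁ ≠ p₂)
    (hm₁ : p₁ % 8 = 5) (hm₂ : p₂ % 8 = 5)
    (e f g h : ℤ) (hef : (p₁ : ℤ) = e ^ 2 + 4 * f ^ 2) (hgh : (p₂ : ℤ) = g ^ 2 + 4 * h ^ 2)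
    (𝕜 K₃ : IntermediateField ℚ ℂ)
    (h𝕜 : 𝕜 = ℚ⟮((Real.sqrt (2 * (p₁ : ℝ) * p₂) : ℝ) : ℂ), Complex.I⟯)
    (hK₃ : K₃ = ℚ⟮((Real.sqrt 2 : ℝ) : ℂ), ((Real.sqrt ((p₁ : ℝ) * p₂) : ℝ) : ℂ), Complex.I⟯)
    [NumberField 𝕜] [NumberField K₃]
    (H₁ H₂ : Ideal (RingOfIntegers 𝕜)) (hH₁p : H₁.IsPrime) (hH₂p : H₂.IsPrime)
    (hH₁ : ∀ u : RingOfIntegers 𝕜,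
      ((algebraMap (RingOfIntegers 𝕜) 𝕜 u : 𝕜) : ℂ) = (e : ℂ) + 2 * f * Complex.I → u ∈ H₁)
    (hH₂ : ∀ u : RingOfIntegers 𝕜,
      ((algebraMap (RingOfIntegers 𝕜) 𝕜 u : 𝕜) : ℂ) = (e : ℂ) - 2 * f * Complex.I → u ∈ H₂)
    (ε₂ εp εd : ℝ)
    (hε₂ : IsFundUnit 2 ε₂) (hεp : IsFundUnit (p₁ * p₂) εp) (hεd : IsFundUnit (2 * p₁ * p₂) εd)
    (φ : RingOfIntegers 𝕜 →+* RingOfIntegers K₃)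
    (hφ : ∀ z : RingOfIntegers 𝕜,
      ((algebraMap (RingOfIntegers K₃) K₃ (φ z) : K₃) : ℂ)
        = ((algebraMap (RingOfIntegers 𝕜) 𝕜 z : 𝕜) : ℂ)) :
    (Ideal.map φ (H₁ * H₂)).IsPrincipal ↔
      ¬ ∃ t : ℝ, t ∈ ℚ⟮Real.sqrt 2, Real.sqrt ((p₁ : ℝ) * p₂)⟯ ∧ t ^ 2 = ε₂ * εp * εd := by
  have hsf : Squarefree (p₁ * p₂) :=
    (Nat.squarefree_mul ((Nat.coprime_primes hp₁ hp₂).2 hne)).2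
      ⟨hp₁.prime.squarefree, hp₂.prime.squarefree⟩
  have hodd : Odd (p₁ * p₂) :=
    (Nat.odd_iff.2 (by omega)).mul (Nat.odd_iff.2 (by omega))
  have hsf2 : Squarefree (2 * (p₁ * p₂)) :=
    (Nat.squarefree_mul hodd.coprime_two_left).2 ⟨Nat.prime_two.prime.squarefree, hsf⟩
  have hn1 : p₁ * p₂ ≠ 1 := fun hn => hp₁.one_lt.ne' (Nat.eq_one_of_mul_eq_one_right hn)
  have hpp : √((p₁ : ℝ) * p₂) = √((p₁ * p₂ : ℕ) : ℝ) := by push_cast; rfl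
  have hK : K₃ = biquadI (p₁ * p₂) := by rw [hK₃, hpp]; rfl
  have hB : ℚ⟮√(2 : ℝ), √((p₁ : ℝ) * p₂)⟯ = biquad (p₁ * p₂) := by rw [hpp]; rfl
  rw [mul_assoc] at hεd
  have hsq : (Ideal.map φ (H₁ * H₂)) ^ 2 = Ideal.span {(p₁ : 𝓞 K₃)} := by
    rw [← Ideal.map_pow, sq_mul_eq_span_of_primes_above hp₁ hp₂ hne (by omega) hef h𝕜 hH₁p hH₂p
      hH₁ hH₂, Ideal.map_span, Set.image_singleton, map_natCast]
  rw [isPrincipal_iff_of_sq_eq_span hp₁.ne_zero hsq, hK, hB]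
  constructor
  · rintro ⟨α, hα, hunit⟩ ⟨t, ht, htsq⟩
    exact biquadI.false_of_sq_div_unit hsf hn1 hodd hε₂ hεp hεd hp₁.ne_zero
      (biquad.sq_ne_natCast_of_mul hp₁ hp₂ hsf hsf2) ht htsq hα hunit
  · intro hns
    refine biquadI.exists_sq_div_unit hp₁ hp₂ hne hm₁ hm₂ hsf hsf2 (π := ⟨e, 2 * f⟩)
      (π' := ⟨g, 2 * h⟩) ?_ ?_ hε₂ hεp hεd hns
    · rw [GaussianInt.norm_eq_sq_add_sq, hef]; ring
    · rw [GaussianInt.norm_eq_sq_add_sq, hgh]; ring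
end
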